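/- arXiv:1508.03816 — 2 statements merged into one kernel-verified Lean document; each statement's English description precedes it below -/
import Mathlib

section
/- Let S ⊂ ℙ²(ℝ) with |S| = 9, and suppose there exists a psd sextic form vanishing at every point of S that is not a sum of squares. Then there exists a psd sextic form q vanishing at every point of S such that q is not a sum of squares and q is extreme in the psd cone (meaning: whenever q = q₁ + q₂ with q₁, q₂ psd sextic forms, then q₁ and q₂ are nonnegative scalar multiples of q). Moreover, any two such extreme forms are positive scalar multiples of each other. -/
open MvPolynomial

noncomputable section

/-- The real projective plane, as lines through the origin of `ℝ³`. -/
abbrev P2 := Projectivization ℝ (Fin 3 → ℝ)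

/-- A polynomial is psd if it takes only nonnegative values on `ℝ³`. -/
def Psd (g : MvPolynomial (Fin 3) ℝ) : Prop := ∀ u : Fin 3 → ℝ, 0 ≤ eval u g

/-- A polynomial is sos if it is a finite sum of squares. -/
def Sos (g : MvPolynomial (Fin 3) ℝ) : Prop :=
  ∃ (n : ℕ) (h : Fin n → MvPolynomial (Fin 3) ℝ), g = ∑ i, (h i) ^ 2

/-- A form vanishes at a point of `ℙ²(ℝ)` if it vanishes at a representative vector. -/
def VanishAt (g : MvPolynomial (Fin 3) ℝ) (P : P2) : Prop := eval P.rep g = 0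

/-- A form is singular at a point of `ℙ²(ℝ)` if it and all its first partial
derivatives vanish at a representative vector. -/
def SingAt (g : MvPolynomial (Fin 3) ℝ) (P : P2) : Prop :=
  eval P.rep g = 0 ∧ ∀ i, eval P.rep (pderiv i g) = 0

/-- `I_d(T)`: the space of degree-`d` forms vanishing at every point of `T`. -/
def Isub (d : ℕ) (T : Set P2) : Submodule ℝ (MvPolynomial (Fin 3) ℝ) :=
  (homogeneousSubmodule (Fin 3) ℝ d) ⊓
  { carrier := {f | ∀ P ∈ T, VanishAt f P}
    zero_mem' := by intro P _; simp [VanishAt]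
    add_mem' := by
      intro a b ha hb P hP
      have h1 := ha P hP; have h2 := hb P hP
      unfold VanishAt at *; simp [h1, h2]
    smul_mem' := by
      intro c f hf P hP
      have h1 := hf P hP
      unfold VanishAt at *; simp [smul_eq_C_mul, h1] }

/-- `I_d(2T)`: the space of degree-`d` forms singular at every point of `T`. -/
def Isub2 (d : ℕ) (T : Set P2) : Submodule ℝ (MvPolynomial (Fin 3) ℝ) :=
  (homogeneousSubmodule (Fin 3) ℝ d) ⊓
  { carrier := {f | ∀ P ∈ T, SingAt f P}
    zero_mem' := by intro P _; constructor <;> simp [SingAt]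
    add_mem' := by
      intro a b ha hb P hP
      obtain ⟨h1, h2⟩ := ha P hP; obtain ⟨h3, h4⟩ := hb P hP
      exact ⟨by simp [h1, h3], fun i => by simp [h2 i, h4 i]⟩
    smul_mem' := by
      intro c f hf P hP
      obtain ⟨h1, h2⟩ := hf P hP
      refine ⟨by simp [smul_eq_C_mul, h1], fun i => ?_⟩
      have := h2 i
      simp [smul_eq_C_mul, this] }

/-- `I₃(T)²`: the span of products of two cubics vanishing on `T`. -/
def IsqCubic (T : Set P2) : Submodule ℝ (MvPolynomial (Fin 3) ℝ) :=
  Submodule.span ℝ {h | ∃ f₁ ∈ Isub 3 T, ∃ f₂ ∈ Isub 3 T, h = f₁ * f₂}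

/-- No 4 points of `T` on a line, no 7 on a conic. -/
def GenPos (T : Set P2) : Prop :=
  (∀ l : MvPolynomial (Fin 3) ℝ, l ≠ 0 → l.IsHomogeneous 1 →
    {P ∈ T | VanishAt l P}.encard ≤ 3) ∧
  (∀ c : MvPolynomial (Fin 3) ℝ, c ≠ 0 → c.IsHomogeneous 2 →
    {P ∈ T | VanishAt c P}.encard ≤ 6)

/-- The real projective zero set of `g`. -/
def VR (g : MvPolynomial (Fin 3) ℝ) : Set P2 := {P | VanishAt g P}


/-- A psd non-sos sextic form `q` is extreme in the psd cone if whenever `q = q₁ + q₂`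
with `q₁, q₂` psd sextic forms, both `q₁` and `q₂` lie in `ℝ₊·q`. -/
def IsExtremeSextic (q : MvPolynomial (Fin 3) ℝ) : Prop :=
  q.IsHomogeneous 6 ∧ Psd q ∧ ¬ Sos q ∧
  ∀ q₁ q₂ : MvPolynomial (Fin 3) ℝ, q₁.IsHomogeneous 6 → q₂.IsHomogeneous 6 →
    Psd q₁ → Psd q₂ → q = q₁ + q₂ →
      (∃ c : ℝ, 0 ≤ c ∧ q₁ = c • q) ∧ (∃ c : ℝ, 0 ≤ c ∧ q₂ = c • q)

abbrev R3 := MvPolynomial (Fin 3) ℝ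
abbrev V3 := Fin 3 → ℝ

lemma finrank_hom (n : ℕ) :
    Module.finrank ℝ (homogeneousSubmodule (Fin 3) ℝ n) = (n + 2).choose 2 := by
  rw [homogeneousSubmodule_eq_finsupp_supported]
  rw [(AddMonoidAlgebra.supportedEquivFinsupp (R := ℝ) (S := ℝ)
    {d : Fin 3 →₀ ℕ | d.degree = n}).finrank_eq]
  have hset : {d : Fin 3 →₀ ℕ | d.degree = n} =
      ((Finset.univ : Finset (Fin 3)).finsuppAntidiag n : Finset (Fin 3 →₀ ℕ)) := by
    ext d
    simp [Finset.mem_finsuppAntidiag, Finsupp.degree_eq_sum]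
  rw [hset]
  rw [Module.finrank_finsupp_self]
  simp only [Finset.coe_sort_coe, Fintype.card_coe]
  rw [Finset.card_finsuppAntidiag_nat_eq_choose]
  simp only [Finset.card_univ, Fintype.card_fin]
  have : 3 + n - 1 = n + 2 := by omega
  rw [this, ← Nat.choose_symm_add]

instance finite_hom (n : ℕ) : Module.Finite ℝ (homogeneousSubmodule (Fin 3) ℝ n) :=
  Module.Finite.iff_fg.mpr (homogeneousSubmodule_fg (Fin 3) ℝ n)

/-- the grading homomorphism `X i ↦ T X i` -/
def grHom : R3 →ₐ[ℝ] Polynomial R3 :=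
  aeval (fun i => Polynomial.C (X i) * Polynomial.X)

lemma grHom_monomial (s : Fin 3 →₀ ℕ) (c : ℝ) :
    grHom (monomial s c) = Polynomial.C (monomial s c) * Polynomial.X ^ s.degree := by
  unfold grHom
  rw [aeval_monomial, monomial_eq, Finsupp.degree_eq_sum]
  rw [Finsupp.prod_fintype _ _ (by simp), Finsupp.prod_fintype _ _ (by simp)]
  simp only [mul_pow, Finset.prod_mul_distrib, Polynomial.C_mul, map_prod, Polynomial.C_pow,
    Finset.prod_pow_eq_pow_sum]
  rw [mul_assoc]
  rfl

lemma grHom_coeff (p : R3) (k : ℕ) : (grHom p).coeff k = homogeneousComponent k p := by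
  induction p using MvPolynomial.induction_on' with
  | monomial s b =>
    rw [grHom_monomial, Polynomial.coeff_C_mul_X_pow]
    rw [homogeneousComponent_of_mem (isHomogeneous_monomial b rfl)]
  | add p q hp hq =>
    rw [map_add, map_add, Polynomial.coeff_add, hp, hq]

lemma isHomogeneous_of_mul {p q : R3} {n : ℕ} (h : (p * q).IsHomogeneous n) (hne : p * q ≠ 0) :
    ∃ a b, p.IsHomogeneous a ∧ q.IsHomogeneous b ∧ a + b = n := by
  have hp : p ≠ 0 := left_ne_zero_of_mul hne
  have hq : q ≠ 0 := right_ne_zero_of_mul hne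
  have inj : ∀ r : R3, r ≠ 0 → grHom r ≠ 0 := by
    intro r hr h0
    apply hr
    rw [← sum_homogeneousComponent r]
    apply Finset.sum_eq_zero
    intro i _
    rw [← grHom_coeff, h0, Polynomial.coeff_zero]
  have key : ∀ r : R3, r ≠ 0 → (grHom r).natDegree = (grHom r).natTrailingDegree →
      ∃ a, r.IsHomogeneous a := by
    intro r hr he
    refine ⟨(grHom r).natDegree, ?_⟩
    have hz : ∀ k, k ≠ (grHom r).natDegree → homogeneousComponent k r = 0 := by
      intro k hk
      rw [← grHom_coeff]
      rcases lt_or_gt_of_ne hk with h | h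
      · exact Polynomial.coeff_eq_zero_of_lt_natTrailingDegree (he ▸ h)
      · exact Polynomial.coeff_eq_zero_of_natDegree_lt h
    have hs := sum_homogeneousComponent r
    set m := (grHom r).natDegree
    by_cases hm : m ∈ Finset.range (r.totalDegree + 1)
    · rw [Finset.sum_eq_single_of_mem m hm (fun k _ hk => hz k hk)] at hs
      rw [← hs]
      exact homogeneousComponent_isHomogeneous m r
    · rw [Finset.sum_eq_zero] at hs
      · exact absurd hs.symm hr
      · intro k hk
        exact hz k (fun hkm => hm (hkm ▸ hk))
  have hprod : grHom (p * q) = Polynomial.C (p * q) * Polynomial.X ^ n := by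
    ext1 k
    rw [grHom_coeff, Polynomial.coeff_C_mul_X_pow, homogeneousComponent_of_mem h]
  have h1 : (grHom (p * q)).natDegree = n := by
    rw [hprod, Polynomial.natDegree_C_mul_X_pow n _ hne]
  have h2 : (grHom (p * q)).natTrailingDegree = n := by
    rw [hprod, Polynomial.C_mul_X_pow_eq_monomial, Polynomial.natTrailingDegree_monomial hne]
  rw [map_mul] at h1 h2
  rw [Polynomial.natDegree_mul (inj p hp) (inj q hq)] at h1
  rw [Polynomial.natTrailingDegree_mul (inj p hp) (inj q hq)] at h2
  have h3 := Polynomial.natTrailingDegree_le_natDegree (grHom p)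
  have h4 := Polynomial.natTrailingDegree_le_natDegree (grHom q)
  obtain ⟨a, ha⟩ := key p hp (by omega)
  obtain ⟨b, hb⟩ := key q hq (by omega)
  exact ⟨a, b, ha, hb, (ha.mul hb).inj_right h hne⟩

lemma isHomogeneous_of_mul_right {p q : R3} {n m : ℕ} (h : (p * q).IsHomogeneous n)
    (hp : p.IsHomogeneous m) (hne : p * q ≠ 0) : m ≤ n ∧ q.IsHomogeneous (n - m) := by
  obtain ⟨a, b, ha, hb, hab⟩ := isHomogeneous_of_mul h hne
  have := ha.inj_right hp (left_ne_zero_of_mul hne)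
  subst this
  refine ⟨by omega, ?_⟩
  have : n - a = b := by omega
  rwa [this]

/-- directional derivative of `h` at `u` along `v` -/
def dd (h : R3) (u v : V3) : ℝ := ∑ j, v j * eval u (pderiv j h)

lemma dd_add (a b : R3) (u v : V3) : dd (a + b) u v = dd a u v + dd b u v := by
  simp [dd, mul_add, Finset.sum_add_distrib]

lemma dd_smul (c : ℝ) (b : R3) (u v : V3) : dd (c • b) u v = c * dd b u v := by
  simp only [dd, Derivation.map_smul, smul_eval, Finset.mul_sum]
  exact Finset.sum_congr rfl (fun j _ => by ring)

lemma dd_neg (b : R3) (u v : V3) : dd (-b) u v = - dd b u v := by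
  simp [dd]

lemma dd_mul (a b : R3) (u v : V3) :
    dd (a * b) u v = eval u a * dd b u v + eval u b * dd a u v := by
  simp only [dd, Derivation.leibniz, smul_eq_mul, map_add, map_mul, Finset.mul_sum,
    ← Finset.sum_add_distrib]
  exact Finset.sum_congr rfl (fun j _ => by ring)

lemma dd_sum {ι : Type*} (s : Finset ι) (a : ι → R3) (u v : V3) :
    dd (∑ i ∈ s, a i) u v = ∑ i ∈ s, dd (a i) u v := by
  simp only [dd, map_sum, Finset.mul_sum]
  exact Finset.sum_comm

lemma dd_euler {h : R3} {n : ℕ} (hh : h.IsHomogeneous n) (u : V3) :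
    dd h u u = n * eval u h := by
  have := congrArg (eval u) hh.sum_X_mul_pderiv
  simpa [dd] using this

/-- directional derivative as a linear map in the direction -/
def ddL (h : R3) (u : V3) : V3 →ₗ[ℝ] ℝ where
  toFun := dd h u
  map_add' v w := by simp [dd, add_mul, Finset.sum_add_distrib]
  map_smul' c v := by simp [dd, Finset.mul_sum, mul_assoc]

@[simp] lemma ddL_apply (h : R3) (u v : V3) : ddL h u v = dd h u v := rfl

/-- a linear form -/
def lin (a : V3) : R3 := ∑ j, C (a j) * X j

lemma lin_hom (a : V3) : (lin a).IsHomogeneous 1 :=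
  IsHomogeneous.sum _ _ _ (fun _ _ => isHomogeneous_C_mul_X _ _)

lemma eval_lin (a u : V3) : eval u (lin a) = ∑ j, a j * u j := by simp [lin]

lemma dd_lin (a u v : V3) : dd (lin a) u v = ∑ j, a j * v j := by
  rw [lin, dd_sum]
  refine Finset.sum_congr rfl (fun j _ => ?_)
  rw [dd, Finset.sum_eq_single j]
  · simp [mul_comm]
  · intro k _ hk
    simp [pderiv_X, Pi.single_apply, hk.symm]
  · simp

lemma exists_sep {P Q : V3} (h : LinearIndependent ℝ ![P, Q]) :
    ∃ a : V3, eval P (lin a) = 1 ∧ eval Q (lin a) = 0 := by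
  obtain ⟨φ, hφ⟩ : ∃ φ : V3 →ₗ[ℝ] ℝ, φ P = 1 ∧ φ Q = 0 := by
    have hP : P ∉ Submodule.span ℝ {Q} := by
      intro hm
      rw [Submodule.mem_span_singleton] at hm
      obtain ⟨c, hc⟩ := hm
      rw [LinearIndependent.pair_iff] at h
      have := h 1 (-c) (by simp [hc])
      simp at this
    obtain ⟨ψ, h1, h2⟩ := Submodule.exists_le_ker_of_notMem hP
    refine ⟨(ψ P)⁻¹ • ψ, ?_, ?_⟩
    · simp [inv_mul_cancel₀ h1]
    · have : ψ Q = 0 := h2 (Submodule.mem_span_singleton_self Q)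
      simp [this]
  have key : ∀ x : V3, φ x = ∑ j, φ (Pi.single j 1) * x j := by
    intro x
    conv_lhs => rw [LinearMap.pi_apply_eq_sum_univ φ x]
    refine Finset.sum_congr rfl (fun j _ => ?_)
    rw [smul_eq_mul, mul_comm]
    congr 2
    ext k
    simp [Pi.single_apply, eq_comm]
  exact ⟨fun j => φ (Pi.single j 1), by rw [eval_lin, ← key, hφ.1], by rw [eval_lin, ← key, hφ.2]⟩

lemma exists_sep' {P : V3} (h : P ≠ 0) : ∃ a : V3, eval P (lin a) = 1 := by
  refine ⟨(∑ j, P j * P j)⁻¹ • P, ?_⟩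
  rw [eval_lin]
  simp only [Pi.smul_apply, smul_eq_mul, mul_assoc, ← Finset.mul_sum]
  apply inv_mul_cancel₀
  intro h0
  apply h
  rw [Finset.sum_eq_zero_iff_of_nonneg (fun j _ => mul_self_nonneg _)] at h0
  ext j
  exact mul_self_eq_zero.mp (h0 j (Finset.mem_univ j))

/-- interpolation: forms of high degree with prescribed differentials at given points. -/
lemma interp {ι : Type*} [Fintype ι] (P : ι → V3) (hP0 : ∀ i, P i ≠ 0)
    (hP : ∀ i j, i ≠ j → LinearIndependent ℝ ![P i, P j]) (r : ℕ) (w : ι → V3 →ₗ[ℝ] ℝ) :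
    ∃ h : R3, h.IsHomogeneous (2 * Fintype.card ι + 1 + r) ∧ ∀ i, ddL h (P i) = w i := by
  classical
  choose b hb using fun i => exists_sep' (hP0 i)
  have hsep : ∀ i j, ∃ a : V3, eval (P i) (lin a) = 1 ∧ (i ≠ j → eval (P j) (lin a) = 0) := by
    intro i j
    by_cases hij : i = j
    · exact ⟨b i, hb i, fun h => absurd hij h⟩
    · obtain ⟨a, h1, h2⟩ := exists_sep (hP i j hij)
      exact ⟨a, h1, fun _ => h2⟩
  choose a ha1 ha2 using hsep
  let H : ι → R3 := fun i => (∏ j, lin (a i j)) * (∏ j, lin (a i j)) * lin (b i) ^ r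
  have Hhom : ∀ i, (H i).IsHomogeneous (2 * Fintype.card ι + r) := by
    intro i
    have h1 : (∏ j, lin (a i j)).IsHomogeneous (Fintype.card ι) := by
      have := IsHomogeneous.prod Finset.univ (fun j => lin (a i j)) (fun _ => 1)
        (fun j _ => lin_hom _)
      simpa using this
    have := (h1.mul h1).mul ((lin_hom (b i)).pow r)
    convert this using 1
    ring
  have Hone : ∀ i, eval (P i) (H i) = 1 := by
    intro i
    simp [H, ha1, hb]
  have Hpz : ∀ i j, i ≠ j → eval (P j) (∏ k, lin (a i k)) = 0 := by
    intro i j hij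
    rw [eval_prod]
    exact Finset.prod_eq_zero (Finset.mem_univ j) (ha2 i j hij)
  have Hz : ∀ i j, i ≠ j → eval (P j) (H i) = 0 := by
    intro i j hij
    simp only [H, map_mul, Hpz i j hij]; ring
  have Hdz : ∀ i j, i ≠ j → ∀ v, dd (H i) (P j) v = 0 := by
    intro i j hij v
    simp only [H, dd_mul, map_mul, Hpz i j hij]; ring
  have hl : ∀ i, ∃ c : V3, ∀ v, eval (P i) (lin c) * dd (H i) (P i) v + dd (lin c) (P i) v = w i v := by
    intro i
    let T : V3 →ₗ[ℝ] Module.Dual ℝ V3 :=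
      { toFun := fun c => eval (P i) (lin c) • ddL (H i) (P i) + ddL (lin c) (P i)
        map_add' := by
          intro c c'
          ext v
          simp [eval_lin, dd_lin, add_mul, Finset.sum_add_distrib]
          ring
        map_smul' := by
          intro t c
          ext v
          simp [eval_lin, dd_lin, Finset.mul_sum, Finset.sum_mul, mul_assoc] }
    have Tinj : Function.Injective T := by
      rw [injective_iff_map_eq_zero]
      intro c hc
      have hc' : ∀ v, eval (P i) (lin c) * dd (H i) (P i) v + dd (lin c) (P i) v = 0 := by
        intro v
        have := LinearMap.congr_fun hc v
        simpa [T] using this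
      have h1 := hc' (P i)
      rw [dd_euler (Hhom i), Hone, dd_euler (lin_hom c)] at h1
      have h2 : eval (P i) (lin c) * ((2 * Fintype.card ι + r : ℕ) + 1 : ℝ) = 0 := by
        rw [← h1]; ring
      have h3 : eval (P i) (lin c) = 0 := by
        rcases mul_eq_zero.mp h2 with h | h
        · exact h
        · exact absurd h (by positivity)
      ext j
      have h4 := hc' (Pi.single j 1)
      rw [h3, zero_mul, zero_add, dd_lin] at h4
      simpa [Pi.single_apply] using h4
    have Tsurj : Function.Surjective T := by
      refine (LinearMap.injective_iff_surjective_of_finrank_eq_finrank ?_).mp Tinj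
      rw [Subspace.dual_finrank_eq]
    obtain ⟨c, hc⟩ := Tsurj (w i)
    refine ⟨c, fun v => ?_⟩
    rw [← hc]
    simp [T]
  choose c hc using hl
  refine ⟨∑ i, H i * lin (c i), ?_, ?_⟩
  · apply IsHomogeneous.sum
    intro i _
    convert (Hhom i).mul (lin_hom (c i)) using 1
    ring
  · intro i
    apply LinearMap.ext
    intro v
    rw [ddL_apply, dd_sum, Finset.sum_eq_single i]
    · rw [dd_mul, Hone, ← hc i v]; ring
    · intro k _ hk
      rw [dd_mul, Hz k i hk, Hdz k i hk]; ring
    · intro h; exact absurd (Finset.mem_univ i) h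

theorem bezout {ι : Type*} [Fintype ι] {d e : ℕ} {f g : R3} (hf : f.IsHomogeneous d)
    (hg : g.IsHomogeneous e) (hf0 : f ≠ 0) (hg0 : g ≠ 0) (hc : IsRelPrime f g)
    (P : ι → V3) (hP0 : ∀ i, P i ≠ 0)
    (hP : ∀ i j, i ≠ j → LinearIndependent ℝ ![P i, P j])
    (V : ι → Submodule ℝ V3)
    (hfP : ∀ i, eval (P i) f = 0) (hgP : ∀ i, eval (P i) g = 0)
    (hfV : ∀ i, ∀ v ∈ V i, dd f (P i) v = 0) (hgV : ∀ i, ∀ v ∈ V i, dd g (P i) v = 0) :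
    ∑ i, Module.finrank ℝ (V i) ≤ d * e := by
  set m := 2 * Fintype.card ι + 1 with hm
  let S := fun n => homogeneousSubmodule (Fin 3) ℝ n
  let Φ : S (m + (d + e)) →ₗ[ℝ] (∀ i, Module.Dual ℝ (V i)) :=
    { toFun := fun h i => (ddL h.1 (P i)).domRestrict (V i)
      map_add' := by
        intro a b; ext i v; simp [dd_add]
      map_smul' := by
        intro a b; ext i v; simp [dd_smul] }
  have Φsurj : Function.Surjective Φ := by
    intro w
    have hext : ∀ i, ∃ w' : V3 →ₗ[ℝ] ℝ, w'.domRestrict (V i) = w i := fun i => by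
      obtain ⟨w', hw'⟩ := LinearMap.exists_extend (w i)
      exact ⟨w', hw'⟩
    choose w' hw' using hext
    obtain ⟨h, hh, hw⟩ := interp P hP0 hP (d + e) w'
    refine ⟨⟨h, hh⟩, ?_⟩
    ext1 i
    simp only [Φ, LinearMap.coe_mk, AddHom.coe_mk]
    rw [hw, hw']
  let ψ : (S (m + e) × S (m + d)) →ₗ[ℝ] S (m + (d + e)) :=
    { toFun := fun ab => ⟨ab.1.1 * f + ab.2.1 * g, by
        have h1 := (show ab.1.1.IsHomogeneous (m + e) from ab.1.2).mul hf
        have h2 := (show ab.2.1.IsHomogeneous (m + d) from ab.2.2).mul hg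
        have e1 : m + e + d = m + (d + e) := by ring
        have e2 : m + d + e = m + (d + e) := by ring
        rw [e1] at h1; rw [e2] at h2
        exact h1.add h2⟩
      map_add' := by
        intro a b; ext1; simp; ring
      map_smul' := by
        intro a b; ext1; simp }
  let κ : S m →ₗ[ℝ] (S (m + e) × S (m + d)) :=
    { toFun := fun c => (⟨c.1 * g, IsHomogeneous.mul c.2 hg⟩, ⟨-(c.1 * f), (IsHomogeneous.mul c.2 hf).neg⟩)
      map_add' := by
        intro a b; ext1 <;> ext1 <;> simp <;> ring
      map_smul' := by
        intro a b; ext1 <;> ext1 <;> simp }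
  have h1 : LinearMap.range ψ ≤ LinearMap.ker Φ := by
    rintro _ ⟨ab, rfl⟩
    rw [LinearMap.mem_ker]
    ext i v
    simp [Φ, ψ, dd_add, dd_mul, hfP, hgP, hfV i v v.2, hgV i v v.2]
  have h2 : LinearMap.ker ψ ≤ LinearMap.range κ := by
    rintro ⟨⟨a, ha⟩, ⟨b, hb⟩⟩ h
    rw [LinearMap.mem_ker] at h
    have h' : a * f + b * g = 0 := congrArg Subtype.val h
    have hd : g ∣ a := by
      apply hc.symm.dvd_of_dvd_mul_right
      exact ⟨-b, by linear_combination h'⟩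
    obtain ⟨c, rfl⟩ := hd
    have hb' : b = -(f * c) := by
      have : g * (b + f * c) = 0 := by linear_combination h'
      rcases mul_eq_zero.mp this with h | h
      · exact absurd h hg0
      · linear_combination h
    by_cases hc0 : c = 0
    · refine ⟨0, ?_⟩
      subst hc0
      ext1 <;> ext1 <;> simp [hb']
    have hch : c.IsHomogeneous m := by
      have := (isHomogeneous_of_mul_right ha hg (mul_ne_zero hg0 hc0)).2
      rwa [Nat.add_sub_cancel] at this
    refine ⟨⟨c, hch⟩, ?_⟩
    ext1 <;> ext1 <;> simp [κ, hb', mul_comm]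
  have d1 := LinearMap.finrank_range_add_finrank_ker Φ
  have d2 := LinearMap.finrank_range_add_finrank_ker ψ
  have d3 := Submodule.finrank_mono h1
  have d4 := Submodule.finrank_mono h2
  have d5 := LinearMap.finrank_range_le κ
  rw [LinearMap.range_eq_top.mpr Φsurj, finrank_top, Module.finrank_pi_fintype] at d1
  simp only [Subspace.dual_finrank_eq] at d1
  rw [Module.finrank_prod] at d2
  have fr : ∀ n, Module.finrank ℝ (S n) = (n + 2).choose 2 := finrank_hom
  rw [fr] at d1 d5
  rw [fr, fr] at d2
  have d6 : (m + (d + e) + 2).choose 2 + (m + 2).choose 2 =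
      (m + e + 2).choose 2 + (m + d + 2).choose 2 + d * e := by
    have : (((m + (d + e) + 2).choose 2 + (m + 2).choose 2 : ℕ) : ℚ) =
      (((m + e + 2).choose 2 + (m + d + 2).choose 2 + d * e : ℕ) : ℚ) := by
      push_cast [Nat.cast_choose_two]
      ring
    exact_mod_cast this
  omega

lemma eval_smul_hom {p : R3} {n : ℕ} (hp : p.IsHomogeneous n) (c : ℝ) (u : V3) :
    eval (c • u) p = c ^ n * eval u p := by
  rw [eval_eq, eval_eq, Finset.mul_sum]
  refine Finset.sum_congr rfl (fun s hs => ?_)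
  have hd : s.degree = n := by
    by_contra h
    exact (mem_support_iff.mp hs) (hp.coeff_eq_zero h)
  simp only [Pi.smul_apply, smul_eq_mul, mul_pow, Finset.prod_mul_distrib,
    Finset.prod_pow_eq_pow_sum]
  have : ∑ i ∈ s.support, s i = n := by rw [← hd]; rfl
  rw [this]; ring

lemma taylor2 (p : R3) (u v : V3) :
    ∃ Q : Polynomial ℝ, ∀ t : ℝ,
      eval (u + t • v) p = eval u p + t * dd p u v + t ^ 2 * Q.eval t := by
  induction p using MvPolynomial.induction_on with
  | C a => exact ⟨0, fun t => by simp [dd]⟩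
  | add p q hp hq =>
    obtain ⟨A, hA⟩ := hp
    obtain ⟨B, hB⟩ := hq
    refine ⟨A + B, fun t => ?_⟩
    rw [map_add, hA, hB, dd_add, map_add, Polynomial.eval_add]; ring
  | mul_X p i hp =>
    obtain ⟨A, hA⟩ := hp
    refine ⟨Polynomial.C (v i) * Polynomial.C (dd p u v) + A * (Polynomial.C (u i) + Polynomial.C (v i) * Polynomial.X), fun t => ?_⟩
    have hX : dd (X i) u v = v i := by
      rw [dd, Finset.sum_eq_single i]
      · simp
      · intro k _ hk
        simp [pderiv_X, hk.symm]
      · simp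
    rw [map_mul, hA, dd_mul, hX]
    simp
    ring

lemma psd_dd {q : R3} (hq : Psd q) {u : V3} (h0 : eval u q = 0) (v : V3) : dd q u v = 0 := by
  obtain ⟨Q, hQ⟩ := taylor2 q u v
  let L : Polynomial ℝ := Polynomial.C (dd q u v) * Polynomial.X + Polynomial.X ^ 2 * Q
  have hL : ∀ t, L.eval t = eval (u + t • v) q := by
    intro t
    rw [hQ, h0]; simp [L]; ring
  have hmin : IsLocalMin (fun t => L.eval t) 0 := by
    apply Filter.Eventually.of_forall
    intro t
    show L.eval 0 ≤ L.eval t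
    rw [hL, hL]
    have := hq (u + t • v)
    simpa [h0] using this
  have := hmin.hasDerivAt_eq_zero (L.hasDerivAt 0)
  simpa [L] using this

/-- restriction of a polynomial to a line -/
def linePoly (p : R3) (u v : V3) : Polynomial ℝ :=
  aeval (fun i => Polynomial.C (u i) + Polynomial.C (v i) * Polynomial.X) p

lemma linePoly_eval (p : R3) (u v : V3) (t : ℝ) :
    (linePoly p u v).eval t = eval (u + t • v) p := by
  induction p using MvPolynomial.induction_on with
  | C a => simp [linePoly]
  | add p q hp hq => 
    rw [map_add, ← hp, ← hq, ← Polynomial.eval_add]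
    simp [linePoly]
  | mul_X p i hp =>
    rw [map_mul, ← hp]
    simp [linePoly]
    left; ring

lemma exists_sign_pt {p : R3} {u v : V3} (hu : 0 < eval u p) (hv : eval v p < 0) :
    ∃ t : ℝ, t ≠ 0 ∧ eval (u + t • (v - u)) p = 0 ∧
      ∀ r : R3, (∀ x, 0 ≤ eval x p * eval x r) → eval (u + t • (v - u)) r = 0 := by
  set L := linePoly p u (v - u) with hL
  have hLe : ∀ t, L.eval t = eval (u + t • (v - u)) p := linePoly_eval p u (v - u)
  have hL0 : 0 < L.eval 0 := by rw [hLe]; simpa using hu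
  have hL1 : L.eval 1 < 0 := by rw [hLe]; simpa using hv
  have hLne : L ≠ 0 := by
    intro h; rw [h] at hL0; simp at hL0
  have hdense : Dense ({t | L.eval t = 0}ᶜ : Set ℝ) := by
    apply Set.Countable.dense_compl ℝ
    apply Set.Finite.countable
    exact (Polynomial.finite_setOfPred_isRoot hLne)
  have hcl : closure {t | 0 < L.eval t} ∪ closure {t | L.eval t < 0} = Set.univ := by
    rw [← closure_union]
    have : {t | 0 < L.eval t} ∪ {t | L.eval t < 0} = ({t | L.eval t = 0}ᶜ : Set ℝ) := by
      ext t
      simp only [Set.mem_union, Set.mem_ofPred_eq, Set.mem_compl_iff]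
      constructor
      · rintro (h | h)
        · exact h.ne'
        · exact h.ne
      · intro h
        rcases lt_or_gt_of_ne h with h | h
        · exact Or.inr h
        · exact Or.inl h
    rw [this, hdense.closure_eq]
  obtain ⟨t, -, ht1, ht2⟩ := isPreconnected_closed_iff.mp (isPreconnected_univ (α := ℝ))
    (closure {t | 0 < L.eval t}) (closure {t | L.eval t < 0})
    isClosed_closure isClosed_closure (by rw [hcl])
    ⟨0, trivial, subset_closure hL0⟩ ⟨1, trivial, subset_closure hL1⟩
  have hpos : ∀ M : Polynomial ℝ, (∀ s, 0 < L.eval s → 0 ≤ M.eval s) → 0 ≤ M.eval t := by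
    intro M hM
    have : closure {t | 0 < L.eval t} ⊆ {s | 0 ≤ M.eval s} :=
      closure_minimal hM (isClosed_le continuous_const M.continuous)
    exact this ht1
  have hneg : ∀ M : Polynomial ℝ, (∀ s, L.eval s < 0 → M.eval s ≤ 0) → M.eval t ≤ 0 := by
    intro M hM
    have : closure {t | L.eval t < 0} ⊆ {s | M.eval s ≤ 0} :=
      closure_minimal hM (isClosed_le M.continuous continuous_const)
    exact this ht2
  have hz : L.eval t = 0 := le_antisymm (hneg L fun s h => h.le) (hpos L fun s h => h.le)
  refine ⟨t, ?_, ?_, ?_⟩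
  · rintro rfl; exact hL0.ne' hz
  · rw [← hLe, hz]
  · intro r hr
    rw [← linePoly_eval]
    have hr' : ∀ s, 0 ≤ L.eval s * (linePoly r u (v - u)).eval s := by
      intro s; rw [hLe, linePoly_eval]; exact hr _
    apply le_antisymm
    · apply hneg
      intro s hs
      have := hr' s
      by_contra hc
      push Not at hc
      nlinarith [mul_pos_of_neg_of_neg (neg_neg_of_pos hc) hs]
    · apply hpos
      intro s hs
      have := hr' s
      by_contra hc
      push Not at hc
      nlinarith [mul_pos_of_neg_of_neg (neg_neg_of_pos hs) hc]

lemma signpts {p : R3} {n : ℕ} (hp : p.IsHomogeneous n) {u v : V3} (hu : 0 < eval u p)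
    (hv : eval v p < 0) (N : ℕ) :
    ∃ w : Fin N → V3, (∀ i, w i ≠ 0) ∧ (∀ i j, i ≠ j → LinearIndependent ℝ ![w i, w j]) ∧
      (∀ i, eval (w i) p = 0) ∧
      ∀ r : R3, (∀ x, 0 ≤ eval x p * eval x r) → ∀ i, eval (w i) r = 0 := by
  have hu0 : u ≠ 0 := by
    rintro rfl
    have := eval_smul_hom hp 0 v
    rw [zero_smul] at this
    rcases Nat.eq_zero_or_pos n with h | h
    · subst h; rw [this] at hu; simp at hu; linarith
    · rw [this, zero_pow h.ne'] at hu; simp at hu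
  obtain ⟨k, hk⟩ : ∃ k, u k ≠ 0 := by
    by_contra h; push Not at h; exact hu0 (funext h)
  obtain ⟨i, j, hik, hjk, hij⟩ : ∃ i j : Fin 3, i ≠ k ∧ j ≠ k ∧ i ≠ j := by
    refine ⟨k + 1, k + 2, ?_, ?_, ?_⟩ <;> fin_cases k <;> decide
  let φ : V3 → ℝ := fun x => x i - u i / u k * x k
  let χ : V3 → ℝ := fun x => x j - u j / u k * x k
  let vv : ℝ → ℝ → V3 := fun s η => v + (s • Pi.single i 1 + η • Pi.single j 1)
  have hcont : Continuous (fun x : ℝ × ℝ => eval (vv x.1 x.2) p) := by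
    apply (MvPolynomial.continuous_eval p).comp
    fun_prop
  have hopen : IsOpen {x : ℝ × ℝ | eval (vv x.1 x.2) p < 0} := isOpen_lt hcont continuous_const
  obtain ⟨δ, hδ, hball⟩ := Metric.isOpen_iff.mp hopen (0, 0) (by simpa [vv] using hv)
  have hneg : ∀ s η, |s| < δ → |η| < δ → eval (vv s η) p < 0 := by
    intro s η hs hη
    have : ((s, η) : ℝ × ℝ) ∈ Metric.ball ((0, 0) : ℝ × ℝ) δ := by
      simp [Prod.dist_eq, hs, hη]
    have h2 := hball this
    rw [Set.mem_ofPred_eq] at h2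
    exact h2
  obtain ⟨η, hη, hχη⟩ : ∃ η, |η| < δ ∧ χ v + η ≠ 0 := by
    by_cases h : χ v + δ / 2 = 0
    · refine ⟨δ / 3, by rw [abs_of_pos (by positivity)]; linarith, ?_⟩
      intro h'; linarith
    · exact ⟨δ / 2, by rw [abs_of_pos (by positivity)]; linarith, h⟩
  let s : Fin N → ℝ := fun a => δ / ((a : ℕ) + 2)
  have hs : ∀ a, |s a| < δ := by
    intro a
    rw [abs_of_pos (by positivity)]
    apply div_lt_self hδ
    have : (0:ℝ) ≤ (a : ℕ) := by positivity
    linarith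
  have hsinj : ∀ a b, s a = s b → a = b := by
    intro a b h
    simp only [s] at h
    rw [div_eq_div_iff (by positivity) (by positivity)] at h
    have := mul_left_cancel₀ hδ.ne' h
    apply Fin.ext
    have h2 : ((b : ℕ) : ℝ) = (a : ℕ) := by linarith
    exact_mod_cast h2.symm
  choose t ht0 htp htr using fun a => exists_sign_pt hu (hneg (s a) η (hs a) hη)
  let w : Fin N → V3 := fun a => u + t a • (vv (s a) η - u)
  have hφw : ∀ a, φ (w a) = t a * (φ v + s a) := by
    intro a
    simp [φ, w, vv, hik.symm, hjk.symm, hij]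
    field_simp
    ring
  have hχw : ∀ a, χ (w a) = t a * (χ v + η) := by
    intro a
    simp [χ, w, vv, hik.symm, hjk.symm, hij.symm]
    field_simp
    ring
  refine ⟨w, ?_, ?_, htp, fun r hr a => htr a r hr⟩
  · intro a h0
    have := hχw a
    rw [h0] at this
    simp [χ] at this
    rcases this with h | h
    · exact ht0 a h
    · exact hχη h
  · intro a b hab
    rw [LinearIndependent.pair_iff]
    intro α β h
    have h1 : α * φ (w a) + β * φ (w b) = 0 := by
      have e1 := congrFun h i
      have e2 := congrFun h k
      simp at e1 e2
      simp only [φ]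
      linear_combination e1 - u i / u k * e2
    have h2 : α * χ (w a) + β * χ (w b) = 0 := by
      have e1 := congrFun h j
      have e2 := congrFun h k
      simp at e1 e2
      simp only [χ]
      linear_combination e1 - u j / u k * e2
    rw [hφw, hφw] at h1
    rw [hχw, hχw] at h2
    have h3 : α * t a + β * t b = 0 := by
      have : (α * t a + β * t b) * (χ v + η) = 0 := by linear_combination h2
      exact (mul_eq_zero.mp this).resolve_right hχη
    have h4 : (α * t a) * (s a - s b) = 0 := by linear_combination h1 - (φ v + s b) * h3
    have hsne : s a - s b ≠ 0 := fun h => hab (hsinj a b (by linarith))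
    have h5 := (mul_eq_zero.mp ((mul_eq_zero.mp h4).resolve_right hsne)).resolve_right (ht0 a)
    refine ⟨h5, ?_⟩
    rw [h5] at h3
    simp at h3
    exact h3.resolve_right (ht0 b)

lemma compact_dom {E : Type*} [NormedAddCommGroup E] [NormedSpace ℝ E] [ProperSpace E] [Nontrivial E]
    {F G : E → ℝ} {k : ℕ} (hk : k ≠ 0) (hF : Continuous F) (hG : Continuous G)
    (hFh : ∀ (t : ℝ) x, F (t • x) = t ^ k * F x) (hGh : ∀ (t : ℝ) x, G (t • x) = t ^ k * G x)
    (hpos : ∀ x, x ≠ 0 → 0 < F x) : ∃ ε : ℝ, 0 < ε ∧ ∀ x, ε * G x ≤ F x := by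
  have hc : IsCompact (Metric.sphere (0 : E) 1) := isCompact_sphere 0 1
  have hne : (Metric.sphere (0 : E) 1).Nonempty := NormedSpace.sphere_nonempty.mpr zero_le_one
  have hn0 : ∀ x ∈ Metric.sphere (0 : E) 1, x ≠ 0 := by
    intro x hx h; subst h; simp at hx
  obtain ⟨a, ha, hamin⟩ := hc.exists_isMinOn hne hF.continuousOn
  obtain ⟨b, hb, hbmax⟩ := hc.exists_isMaxOn hne hG.continuousOn
  have hFa := hpos a (hn0 a ha)
  refine ⟨F a / (|G b| + 1), by positivity, ?_⟩
  intro x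
  by_cases hx : x = 0
  · have h1 := hFh 0 x
    have h2 := hGh 0 x
    rw [zero_smul, zero_pow hk, zero_mul] at h1 h2
    subst hx
    rw [h1, h2]; simp
  · have hnx : ‖x‖ ≠ 0 := norm_ne_zero_iff.mpr hx
    set u := ‖x‖⁻¹ • x with hu
    have hxu : x = ‖x‖ • u := by rw [hu, smul_smul, mul_inv_cancel₀ hnx, one_smul]
    have hus : u ∈ Metric.sphere (0 : E) 1 := by
      simp [hu, norm_smul, inv_mul_cancel₀ hnx]
    have h1 : F a ≤ F u := hamin hus
    have h2 : G u ≤ G b := hbmax hus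
    rw [hxu, hFh, hGh]
    have h3 : F a / (|G b| + 1) * G u ≤ F u := by
      have h4 : G u ≤ |G b| + 1 := by linarith [le_abs_self (G b)]
      have h5 : F a / (|G b| + 1) * G u ≤ F a / (|G b| + 1) * (|G b| + 1) :=
        mul_le_mul_of_nonneg_left h4 (by positivity)
      rw [div_mul_cancel₀ _ (by positivity)] at h5
      linarith
    have h6 : 0 ≤ ‖x‖ ^ k := by positivity
    calc _ = ‖x‖ ^ k * (F a / (|G b| + 1) * G u) := by ring
      _ ≤ _ := mul_le_mul_of_nonneg_left h3 h6

lemma nonneg_at {F : ℝ → ℝ} (hF : Continuous F) (a : ℝ) (h : ∀ y, y ≠ a → 0 ≤ F y) : 0 ≤ F a := by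
  have hd : Dense ({a}ᶜ : Set ℝ) := dense_compl_singleton a
  have hcl : IsClosed {y | 0 ≤ F y} := isClosed_le continuous_const hF
  have : closure ({a}ᶜ : Set ℝ) ⊆ {y | 0 ≤ F y} := closure_minimal (fun y hy => h y hy) hcl
  rw [hd.closure_eq] at this
  exact this (Set.mem_univ a)

lemma quad_nonneg {f g h : ℝ} (H : ∀ x : ℝ, 0 ≤ x ^ 2 * f + 2 * x * g + h) :
    0 ≤ f ∧ 0 ≤ h ∧ g ^ 2 ≤ f * h := by
  have hh : 0 ≤ h := by have := H 0; simpa using this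
  have hd := discrim_le_zero (a := f) (b := 2 * g) (c := h) (fun x => by have := H x; nlinarith)
  unfold discrim at hd
  have hfh : g ^ 2 ≤ f * h := by nlinarith
  refine ⟨?_, hh, hfh⟩
  by_contra hf
  push Not at hf
  have : f * h ≤ 0 := mul_nonpos_of_nonpos_of_nonneg hf.le hh
  have hg : g = 0 := by
    have : g ^ 2 = 0 := le_antisymm (by linarith) (sq_nonneg g)
    exact pow_eq_zero_iff (by norm_num) |>.mp this
  have hfh0 : f * h = 0 := le_antisymm this (by rw [hg] at hfh; simpa using hfh)
  have hh0 : h = 0 := (mul_eq_zero.mp hfh0).resolve_left hf.ne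
  have := H 1
  rw [hg, hh0] at this
  linarith

lemma lin_coeff_zero {α β γ δ : ℝ} (H : ∀ t : ℝ, 0 ≤ t * α + t ^ 2 * β + t ^ 3 * γ + t ^ 4 * δ) : α = 0 := by
  have hc : Continuous (fun t : ℝ => α + t * β + t ^ 2 * γ + t ^ 3 * δ) := by fun_prop
  have h1 : 0 ≤ α := by
    have := nonneg_at (F := fun t => α + |t| * β + |t| ^ 2 * γ + |t| ^ 3 * δ) (by fun_prop) 0 (by
      intro t ht
      have h := H |t|
      have ht' : 0 < |t| := abs_pos.mpr ht
      have : 0 ≤ |t| * (α + |t| * β + |t| ^ 2 * γ + |t| ^ 3 * δ) := by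
        linarith [h]
      exact nonneg_of_mul_nonneg_right this ht')
    simpa using this
  have h2 : 0 ≤ -α := by
    have := nonneg_at (F := fun t => -α + |t| * β - |t| ^ 2 * γ + |t| ^ 3 * δ) (by fun_prop) 0 (by
      intro t ht
      have h := H (-|t|)
      have ht' : 0 < |t| := abs_pos.mpr ht
      have : 0 ≤ |t| * (-α + |t| * β - |t| ^ 2 * γ + |t| ^ 3 * δ) := by
        linarith [h]
      exact nonneg_of_mul_nonneg_right this ht')
    simpa using this
  linarith

lemma vec_eta (v : V3) : v = ![v 0, v 1, v 2] := by
  ext i; fin_cases i <;> rfl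

lemma euler_split {p : R3} {n : ℕ} (hp : p.IsHomogeneous (n + 1)) :
    ∃ p0 p1 p2 : R3, p0.IsHomogeneous n ∧ p1.IsHomogeneous n ∧ p2.IsHomogeneous n ∧
      ∀ x y z : ℝ, eval ![x, y, z] p =
        x * eval ![x, y, z] p0 + y * eval ![x, y, z] p1 + z * eval ![x, y, z] p2 := by
  have hpd : ∀ i, (C ((n + 1 : ℝ)⁻¹) * pderiv i p).IsHomogeneous n := fun i =>
    (hp.pderiv (i := i)).C_mul _
  refine ⟨_, _, _, hpd 0, hpd 1, hpd 2, ?_⟩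
  intro x y z
  have := congrArg (eval ![x, y, z]) hp.sum_X_mul_pderiv
  simp [Fin.sum_univ_three] at this
  simp
  have hn : (n + 1 : ℝ) ≠ 0 := by positivity
  field_simp
  linarith

lemma hom0 {p : R3} (hp : p.IsHomogeneous 0) : ∃ a : ℝ, ∀ x y z : ℝ, eval ![x, y, z] p = a := by
  rw [← totalDegree_zero_iff_isHomogeneous, totalDegree_eq_zero_iff_eq_C] at hp
  exact ⟨_, fun x y z => by rw [hp, eval_C]⟩

lemma hom1 {p : R3} (hp : p.IsHomogeneous 1) :
    ∃ a b c : ℝ, ∀ x y z : ℝ, eval ![x, y, z] p = a * x + b * y + c * z := by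
  obtain ⟨p0, p1, p2, h0, h1, h2, H⟩ := euler_split hp
  obtain ⟨a, ha⟩ := hom0 h0
  obtain ⟨b, hb⟩ := hom0 h1
  obtain ⟨c, hc⟩ := hom0 h2
  exact ⟨a, b, c, fun x y z => by rw [H, ha, hb, hc]; ring⟩

lemma hom2 {p : R3} (hp : p.IsHomogeneous 2) :
    ∃ a b c d e f : ℝ, ∀ x y z : ℝ, eval ![x, y, z] p =
      a * x ^ 2 + x * (b * y + c * z) + (d * y ^ 2 + e * y * z + f * z ^ 2) := by
  obtain ⟨p0, p1, p2, h0, h1, h2, H⟩ := euler_split hp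
  obtain ⟨a, b, c, ha⟩ := hom1 h0
  obtain ⟨a', b', c', hb⟩ := hom1 h1
  obtain ⟨a'', b'', c'', hc⟩ := hom1 h2
  exact ⟨a, b + a', c + a'', b', c' + b'', c'', fun x y z => by rw [H, ha, hb, hc]; ring⟩

lemma hom3 {p : R3} (hp : p.IsHomogeneous 3) :
    ∃ a b c d e f g0 g1 g2 g3 : ℝ, ∀ x y z : ℝ, eval ![x, y, z] p =
      a * x ^ 3 + x ^ 2 * (b * y + c * z) + x * (d * y ^ 2 + e * y * z + f * z ^ 2) +
        (g0 * y ^ 3 + g1 * y ^ 2 * z + g2 * y * z ^ 2 + g3 * z ^ 3) := by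
  obtain ⟨p0, p1, p2, h0, h1, h2, H⟩ := euler_split hp
  obtain ⟨a, b, c, d, e, f, ha⟩ := hom2 h0
  obtain ⟨a', b', c', d', e', f', hb⟩ := hom2 h1
  obtain ⟨a'', b'', c'', d'', e'', f'', hc⟩ := hom2 h2
  exact ⟨a, b + a', c + a'', d + b', e + c' + b'', f + c'', d', e' + d'', f' + e'', f'',
    fun x y z => by rw [H, ha, hb, hc]; ring⟩

lemma hom4 {p : R3} (hp : p.IsHomogeneous 4) :
    ∃ a b c f0 f1 f2 g0 g1 g2 g3 h0 h1 h2 h3 h4 : ℝ, ∀ x y z : ℝ, eval ![x, y, z] p =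
      a * x ^ 4 + x ^ 3 * (b * y + c * z) + x ^ 2 * (f0 * y ^ 2 + f1 * y * z + f2 * z ^ 2) +
        2 * x * (g0 * y ^ 3 + g1 * y ^ 2 * z + g2 * y * z ^ 2 + g3 * z ^ 3) +
        (h0 * y ^ 4 + h1 * y ^ 3 * z + h2 * y ^ 2 * z ^ 2 + h3 * y * z ^ 3 + h4 * z ^ 4) := by
  obtain ⟨p0, p1, p2, h0, h1, h2, H⟩ := euler_split hp
  obtain ⟨a, b, c, d, e, f, g0, g1, g2, g3, ha⟩ := hom3 h0
  obtain ⟨a', b', c', d', e', f', g0', g1', g2', g3', hb⟩ := hom3 h1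
  obtain ⟨a'', b'', c'', d'', e'', f'', g0'', g1'', g2'', g3'', hc⟩ := hom3 h2
  exact ⟨a, b + a', c + a'', d + b', e + c' + b'', f + c'',
    (g0 + d') / 2, (g1 + e' + d'') / 2, (g2 + f' + e'') / 2, (g3 + f'') / 2,
    g0', g1' + g0'', g2' + g1'', g3' + g2'', g3'',
    fun x y z => by rw [H, ha, hb, hc]; ring⟩

/-- `T` dominates the square of a nonzero form of degree `k`. -/
def Dom (k : ℕ) (T : R3) : Prop :=
  ∃ s : R3, s.IsHomogeneous k ∧ s ≠ 0 ∧ ∀ v, (eval v s) ^ 2 ≤ eval v T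

lemma mkDom {T : R3} (a b c d e f : ℝ)
    (hne : ∃ x y z : ℝ, a * x ^ 2 + x * (b * y + c * z) + (d * y ^ 2 + e * y * z + f * z ^ 2) ≠ 0)
    (H : ∀ x y z : ℝ, (a * x ^ 2 + x * (b * y + c * z) + (d * y ^ 2 + e * y * z + f * z ^ 2)) ^ 2 ≤
      eval ![x, y, z] T) : Dom 2 T := by
  let s : R3 := C a * (X 0 * X 0) + X 0 * (C b * X 1 + C c * X 2) +
    (C d * (X 1 * X 1) + C e * (X 1 * X 2) + C f * (X 2 * X 2))
  have hs : ∀ x y z : ℝ, eval ![x, y, z] s =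
      a * x ^ 2 + x * (b * y + c * z) + (d * y ^ 2 + e * y * z + f * z ^ 2) := by
    intro x y z; simp [s]; ring
  have hX : ∀ i : Fin 3, (X i : R3).IsHomogeneous 1 := fun i => isHomogeneous_X _ _
  refine ⟨s, ?_, ?_, ?_⟩
  · have hXX : ∀ (r : ℝ) (i j : Fin 3), (C r * (X i * X j) : R3).IsHomogeneous 2 := fun r i j =>
      ((hX i).mul (hX j)).C_mul r
    exact ((hXX a 0 0).add ((hX 0).mul (((hX 1).C_mul b).add ((hX 2).C_mul c)))).add
      (((hXX d 1 1).add (hXX e 1 2)).add (hXX f 2 2))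
  · intro h
    obtain ⟨x, y, z, hxyz⟩ := hne
    apply hxyz
    rw [← hs, h, map_zero]
  · intro v
    rw [vec_eta v, hs]
    exact H _ _ _

/-- linear substitution -/
def lsub (A : Matrix (Fin 3) (Fin 3) ℝ) (p : R3) : R3 := aeval (fun i => lin (A i)) p

lemma eval_lsub (A : Matrix (Fin 3) (Fin 3) ℝ) (p : R3) (v : V3) :
    eval v (lsub A p) = eval (A.mulVec v) p := by
  unfold lsub
  have : (eval v) ((aeval fun i => lin (A i)) p) = eval₂ (RingHom.id ℝ) (fun i => eval v (lin (A i))) p := by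
    rw [aeval_def, ← coe_eval₂Hom, ← RingHom.comp_apply, comp_eval₂Hom]
    simp only [coe_eval₂Hom]
    congr 1
    ext r; simp
  rw [this, eval₂_id]
  congr 2
  ext i
  rw [eval_lin]; rfl

lemma lsub_hom (A : Matrix (Fin 3) (Fin 3) ℝ) {p : R3} {n : ℕ} (hp : p.IsHomogeneous n) :
    (lsub A p).IsHomogeneous n := by
  have := hp.aeval (fun i => lin (A i)) (n := 1) (fun i => lin_hom _)
  rwa [one_mul] at this

lemma dom_lsub {k : ℕ} {T : R3} (A : Matrix (Fin 3) (Fin 3) ℝ) (hA : A.det ≠ 0)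
    (h : Dom k (lsub A T)) : Dom k T := by
  obtain ⟨s, hs, hs0, H⟩ := h
  have hu : IsUnit A.det := isUnit_iff_ne_zero.mpr hA
  refine ⟨lsub A⁻¹ s, lsub_hom _ hs, ?_, ?_⟩
  · intro h0
    apply hs0
    apply MvPolynomial.funext
    intro v
    have := eval_lsub A⁻¹ s (A.mulVec v)
    rw [h0, Matrix.mulVec_mulVec, Matrix.nonsing_inv_mul _ hu, Matrix.one_mulVec] at this
    rw [← this]; simp
  · intro v
    rw [eval_lsub]
    have := H (A⁻¹.mulVec v)
    rwa [eval_lsub, Matrix.mulVec_mulVec, Matrix.mul_nonsing_inv _ hu, Matrix.one_mulVec] at this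

lemma exists_eval_ne {p : R3} (hp : p ≠ 0) : ∃ u : V3, eval u p ≠ 0 := by
  by_contra h
  push Not at h
  exact hp (MvPolynomial.funext (fun v => by rw [h v, map_zero]))

lemma quad_dom {p : R3} (hp : p.IsHomogeneous 2) (hpsd : Psd p) (h0 : p ≠ 0) : Dom 1 p := by
  obtain ⟨u, hu⟩ := exists_eval_ne h0
  obtain ⟨a, b, c, d, e, f, H⟩ := hom2 hp
  have hQ : 0 < eval u p := lt_of_le_of_ne (hpsd u) (Ne.symm hu)
  set Q := eval u p with hQdef
  have hQ' : Q = a * u 0 ^ 2 + u 0 * (b * u 1 + c * u 2) +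
      (d * u 1 ^ 2 + e * u 1 * u 2 + f * u 2 ^ 2) := by
    rw [hQdef, ← H, ← vec_eta]
  set r := Real.sqrt Q with hr
  have hrpos : 0 < r := Real.sqrt_pos.mpr hQ
  have hr2 : r ^ 2 = Q := Real.sq_sqrt hQ.le
  let w : V3 := ![(2 * a * u 0 + b * u 1 + c * u 2) / (2 * r),
    (b * u 0 + 2 * d * u 1 + e * u 2) / (2 * r), (c * u 0 + e * u 1 + 2 * f * u 2) / (2 * r)]
  have hw : ∀ v : V3, eval v (lin w) = ((2 * a * u 0 + b * u 1 + c * u 2) * v 0 +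
      (b * u 0 + 2 * d * u 1 + e * u 2) * v 1 + (c * u 0 + e * u 1 + 2 * f * u 2) * v 2) / (2 * r) := by
    intro v
    rw [eval_lin]
    simp [Fin.sum_univ_three, w]
    ring
  refine ⟨lin w, lin_hom w, ?_, ?_⟩
  · intro h
    have h1 := hw u
    rw [h, map_zero] at h1
    have h2 : (2 * a * u 0 + b * u 1 + c * u 2) * u 0 +
      (b * u 0 + 2 * d * u 1 + e * u 2) * u 1 + (c * u 0 + e * u 1 + 2 * f * u 2) * u 2 = 2 * Q := by
      rw [hQ']; ring
    rw [h2] at h1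
    have : 0 < 2 * Q / (2 * r) := by positivity
    linarith
  · intro v
    rw [hw]
    set Bv := (2 * a * u 0 + b * u 1 + c * u 2) * v 0 +
      (b * u 0 + 2 * d * u 1 + e * u 2) * v 1 + (c * u 0 + e * u 1 + 2 * f * u 2) * v 2 with hB
    have hq := quad_nonneg (f := Q) (g := Bv / 2) (h := eval v p) (by
      intro x
      have h1 := hpsd ![x * u 0 + v 0, x * u 1 + v 1, x * u 2 + v 2]
      rw [H] at h1
      have h2 : eval v p = a * v 0 ^ 2 + v 0 * (b * v 1 + c * v 2) +
      (d * v 1 ^ 2 + e * v 1 * v 2 + f * v 2 ^ 2) := by rw [← H, ← vec_eta]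
      rw [h2, hQ', hB]
      refine h1.trans_eq ?_
      ring)
    have h3 := hq.2.2
    rw [div_pow, div_le_iff₀ (by positivity), mul_pow, hr2]
    nlinarith

lemma bq {A B D : ℝ} (H : ∀ y z : ℝ, 0 ≤ A * y ^ 2 + B * y * z + D * z ^ 2)
    (hne : ∃ y z : ℝ, A * y ^ 2 + B * y * z + D * z ^ 2 ≠ 0) :
    ∃ α β : ℝ, (α ≠ 0 ∨ β ≠ 0) ∧ ∀ y z : ℝ, (α * y + β * z) ^ 2 ≤ A * y ^ 2 + B * y * z + D * z ^ 2 := by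
  have hq := quad_nonneg (f := A) (g := B / 2) (h := D) (fun x => by
    have := H x 1
    refine this.trans_eq ?_; ring)
  obtain ⟨hA, hD, hB⟩ := hq
  rcases hA.lt_or_eq with hA | hA
  · set r := Real.sqrt A with hr
    have hrpos : 0 < r := Real.sqrt_pos.mpr hA
    have hr2 : r ^ 2 = A := Real.sq_sqrt hA.le
    refine ⟨r, B / (2 * r), Or.inl hrpos.ne', ?_⟩
    intro y z
    have h1 : (r * y + B / (2 * r) * z) ^ 2 = A * y ^ 2 + B * y * z + (B / 2) ^ 2 / A * z ^ 2 := by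
      rw [← hr2]; field_simp; ring
    rw [h1]
    have h2 : (B / 2) ^ 2 / A ≤ D := by rw [div_le_iff₀ hA]; linarith
    nlinarith [mul_le_mul_of_nonneg_right h2 (sq_nonneg z)]
  · subst hA
    have hB0 : B = 0 := by nlinarith [sq_nonneg B]
    subst hB0
    refine ⟨0, Real.sqrt D, ?_, ?_⟩
    · right
      intro h
      rw [Real.sqrt_eq_zero hD] at h
      subst h
      obtain ⟨y, z, h⟩ := hne
      simp at h
    · intro y z
      have : (0 * y + Real.sqrt D * z) ^ 2 = D * z ^ 2 := by
        rw [zero_mul, zero_add, mul_pow, Real.sq_sqrt hD]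
      rw [this]; simp

lemma exists_eval_ne' {p : R3} (hp : p ≠ 0) : ∃ x y z : ℝ, eval ![x, y, z] p ≠ 0 := by
  obtain ⟨u, hu⟩ := exists_eval_ne hp
  exact ⟨u 0, u 1, u 2, by rwa [← vec_eta]⟩

lemma lsub_ne {A : Matrix (Fin 3) (Fin 3) ℝ} (hA : A.det ≠ 0) {p : R3} (hp : p ≠ 0) : lsub A p ≠ 0 := by
  have hu : IsUnit A.det := isUnit_iff_ne_zero.mpr hA
  intro h
  obtain ⟨u, hu'⟩ := exists_eval_ne hp
  have := eval_lsub A p (A⁻¹.mulVec u)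
  rw [h, Matrix.mulVec_mulVec, Matrix.mul_nonsing_inv _ hu, Matrix.one_mulVec] at this
  simp at this
  exact hu' this.symm

lemma lsub_psd {A : Matrix (Fin 3) (Fin 3) ℝ} {p : R3} (hp : Psd p) : Psd (lsub A p) := by
  intro u; rw [eval_lsub]; exact hp _

lemma eval_lsub_mk (a b c d e f g h i : ℝ) (p : R3) (x y z : ℝ) :
    eval ![x, y, z] (lsub !![a, b, c; d, e, f; g, h, i] p) =
      eval ![a * x + b * y + c * z, d * x + e * y + f * z, g * x + h * y + i * z] p := by
  rw [eval_lsub]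
  congr 2
  ext j
  fin_cases j <;> simp [Matrix.mulVec, dotProduct, Fin.sum_univ_three]

lemma bin4 {T : R3} (hpsd : Psd T) (h0 : T ≠ 0) (a0 a1 a2 a3 a4 : ℝ)
    (H : ∀ x y z : ℝ, eval ![x, y, z] T =
      a0 * y ^ 4 + a1 * y ^ 3 * z + a2 * y ^ 2 * z ^ 2 + a3 * y * z ^ 3 + a4 * z ^ 4) : Dom 2 T := by
  by_cases hz : ∃ b c : ℝ, (b ≠ 0 ∨ c ≠ 0) ∧
      a0 * b ^ 4 + a1 * b ^ 3 * c + a2 * b ^ 2 * c ^ 2 + a3 * b * c ^ 3 + a4 * c ^ 4 = 0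
  · obtain ⟨b, c, hbc, hz⟩ := hz
    have hN : 0 < b ^ 2 + c ^ 2 := by
      rcases hbc with h | h
      · have := pow_pos (abs_pos.mpr h) 2; rw [sq_abs] at this; positivity
      · have := pow_pos (abs_pos.mpr h) 2; rw [sq_abs] at this; positivity
    have hdet : (!![1, 0, 0; 0, c, b; 0, -b, c] : Matrix (Fin 3) (Fin 3) ℝ).det ≠ 0 := by
      rw [Matrix.det_fin_three]; simp; nlinarith
    apply dom_lsub _ hdet
    set T' := lsub !![1, 0, 0; 0, c, b; 0, -b, c] T with hT'
    have hp' : Psd T' := lsub_psd hpsd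
    have h0' : T' ≠ 0 := lsub_ne hdet h0
    obtain ⟨c0, c1, c2, c3, c4, H'⟩ : ∃ c0 c1 c2 c3 c4 : ℝ, ∀ x y z : ℝ, eval ![x, y, z] T' =
        c0 * y ^ 4 + c1 * y ^ 3 * z + c2 * y ^ 2 * z ^ 2 + c3 * y * z ^ 3 + c4 * z ^ 4 := by
      refine ⟨a0 * c ^ 4 - a1 * c ^ 3 * b + a2 * c ^ 2 * b ^ 2 - a3 * c * b ^ 3 + a4 * b ^ 4,
        a0 * 4 * c ^ 3 * b + a1 * (c ^ 4 - 3 * c ^ 2 * b ^ 2) + a2 * (2 * c * b ^ 3 - 2 * c ^ 3 * b)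
          + a3 * (3 * b ^ 2 * c ^ 2 - b ^ 4) - a4 * 4 * b ^ 3 * c,
        a0 * 6 * c ^ 2 * b ^ 2 + a1 * (3 * c ^ 3 * b - 3 * c * b ^ 3) +
          a2 * (c ^ 4 - 4 * b ^ 2 * c ^ 2 + b ^ 4) + a3 * (3 * b ^ 3 * c - 3 * b * c ^ 3)
          + a4 * 6 * b ^ 2 * c ^ 2,
        a0 * 4 * c * b ^ 3 + a1 * (3 * c ^ 2 * b ^ 2 - b ^ 4) + a2 * (2 * c ^ 3 * b - 2 * c * b ^ 3)
          + a3 * (c ^ 4 - 3 * c ^ 2 * b ^ 2) - a4 * 4 * b * c ^ 3,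
        a0 * b ^ 4 + a1 * b ^ 3 * c + a2 * b ^ 2 * c ^ 2 + a3 * b * c ^ 3 + a4 * c ^ 4, ?_⟩
      intro x y z
      rw [hT', eval_lsub_mk, H]
      ring
    have hc4 : c4 = 0 := by
      have := H' 0 0 1
      rw [hT', eval_lsub_mk, H] at this
      simp at this
      rw [← this, ← hz]
    subst hc4
    have hc3 : c3 = 0 := lin_coeff_zero (β := c2) (γ := c1) (δ := c0) (fun t => by
      have := hp' ![0, t, 1]
      rw [H'] at this
      refine this.trans_eq ?_; ring)
    subst hc3
    have hk : ∀ y z : ℝ, 0 ≤ c0 * y ^ 2 + c1 * y * z + c2 * z ^ 2 := by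
      intro y z
      apply nonneg_at (F := fun y => c0 * y ^ 2 + c1 * y * z + c2 * z ^ 2) (by fun_prop) y
      intro y' _
      by_cases hy : y' = 0
      · subst hy
        apply nonneg_at (F := fun y => c0 * y ^ 2 + c1 * y * z + c2 * z ^ 2) (by fun_prop) 0
        intro y hy
        have := hp' ![0, y, z]
        rw [H'] at this
        have hy2 : 0 < y ^ 2 := by positivity
        refine nonneg_of_mul_nonneg_right (this.trans_eq ?_) hy2
        ring
      · have := hp' ![0, y', z]
        rw [H'] at this
        have hy2 : 0 < y' ^ 2 := by positivity
        refine nonneg_of_mul_nonneg_right (this.trans_eq ?_) hy2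
        ring
    obtain ⟨α, β, hαβ, hl⟩ := bq hk (by
      obtain ⟨x, y, z, hne⟩ := exists_eval_ne' h0'
      refine ⟨y, z, fun h => hne ?_⟩
      rw [H']
      linear_combination y ^ 2 * h)
    refine mkDom 0 0 0 α β 0 ?_ ?_
    · by_contra hcon
      push Not at hcon
      have e1 := hcon 0 1 0
      have e2 := hcon 0 1 1
      simp at e1 e2
      rw [e1] at e2
      simp at e2
      rcases hαβ with h | h
      · exact h e1
      · exact h e2
    · intro x y z
      rw [H']
      have := mul_le_mul_of_nonneg_left (hl y z) (sq_nonneg y)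
      nlinarith
  · push Not at hz
    obtain ⟨ε, hε, hd⟩ := compact_dom (E := ℝ × ℝ) (k := 4)
      (F := fun p => a0 * p.1 ^ 4 + a1 * p.1 ^ 3 * p.2 + a2 * p.1 ^ 2 * p.2 ^ 2 + a3 * p.1 * p.2 ^ 3 + a4 * p.2 ^ 4)
      (G := fun p => p.1 ^ 4) (by norm_num) (by fun_prop) (by fun_prop)
      (by intro t x; simp; ring) (by intro t x; simp; ring) (by
        intro x hx
        refine lt_of_le_of_ne ?_ (Ne.symm (hz _ _ ?_))
        · rw [← H 0]; exact hpsd _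
        · by_contra h
          push Not at h
          exact hx (Prod.ext h.1 h.2))
    refine mkDom 0 0 0 (Real.sqrt ε) 0 0 ⟨0, 1, 0, by simp; positivity⟩ ?_
    intro x y z
    rw [H]
    refine le_trans (le_of_eq ?_) (hd (y, z))
    simp only [zero_mul, zero_add, mul_zero, add_zero, mul_pow, Real.sq_sqrt hε.le]
    ring

lemma caseA {T : R3} (hpsd : Psd T) (h0 : T ≠ 0) (f0 g0 g1 g2 g3 a0 a1 a2 a3 a4 : ℝ)
    (H : ∀ x y z : ℝ, eval ![x, y, z] T = x ^ 2 * (f0 * y ^ 2) +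
        2 * x * (g0 * y ^ 3 + g1 * y ^ 2 * z + g2 * y * z ^ 2 + g3 * z ^ 3) +
      (a0 * y ^ 4 + a1 * y ^ 3 * z + a2 * y ^ 2 * z ^ 2 + a3 * y * z ^ 3 + a4 * z ^ 4)) : Dom 2 T := by
  have hq := fun y z : ℝ => quad_nonneg (f := f0 * y ^ 2)
    (g := g0 * y ^ 3 + g1 * y ^ 2 * z + g2 * y * z ^ 2 + g3 * z ^ 3)
    (h := a0 * y ^ 4 + a1 * y ^ 3 * z + a2 * y ^ 2 * z ^ 2 + a3 * y * z ^ 3 + a4 * z ^ 4)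
    (fun x => by rw [← H]; exact hpsd _)
  have hf0 : 0 ≤ f0 := by have := (hq 1 0).1; simpa using this
  have hg3 : g3 = 0 := by
    have := (hq 0 1).2.2
    simp at this
    nlinarith [sq_nonneg g3]
  subst hg3
  rcases hf0.lt_or_eq with hf | hf
  · set r := Real.sqrt f0 with hr
    have hrpos : 0 < r := Real.sqrt_pos.mpr hf
    have hr2 : r ^ 2 = f0 := Real.sq_sqrt hf.le
    have hnn : ∀ y z : ℝ, 0 ≤ f0 * (a0 * y ^ 4 + a1 * y ^ 3 * z + a2 * y ^ 2 * z ^ 2 + a3 * y * z ^ 3 + a4 * z ^ 4)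
        - (g0 * y ^ 2 + g1 * y * z + g2 * z ^ 2) ^ 2 := by
      have key : ∀ y z : ℝ, y ≠ 0 → 0 ≤ f0 * (a0 * y ^ 4 + a1 * y ^ 3 * z + a2 * y ^ 2 * z ^ 2 + a3 * y * z ^ 3 + a4 * z ^ 4)
        - (g0 * y ^ 2 + g1 * y * z + g2 * z ^ 2) ^ 2 := by
        intro y z hy
        have := (hq y z).2.2
        have hy2 : 0 < y ^ 2 := by positivity
        refine nonneg_of_mul_nonneg_right ((sub_nonneg.mpr this).trans_eq ?_) hy2
        ring
      intro y z
      by_cases hy : y = 0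
      · subst hy
        exact nonneg_at (F := fun y => f0 * (a0 * y ^ 4 + a1 * y ^ 3 * z + a2 * y ^ 2 * z ^ 2 + a3 * y * z ^ 3 + a4 * z ^ 4)
        - (g0 * y ^ 2 + g1 * y * z + g2 * z ^ 2) ^ 2) (by fun_prop) 0 (fun y hy => key y z hy)
      · exact key y z hy
    refine mkDom 0 r 0 (g0 / r) (g1 / r) (g2 / r) ?_ ?_
    · by_contra hcon
      push Not at hcon
      have e1 := hcon 1 1 0
      have e2 := hcon (-1) 1 0
      simp at e1 e2
      linarith
    · intro x y z
      rw [H]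
      have h1 : (0 * x ^ 2 + x * (r * y + 0 * z) + (g0 / r * y ^ 2 + g1 / r * y * z + g2 / r * z ^ 2)) ^ 2
          = (f0 * x * y + (g0 * y ^ 2 + g1 * y * z + g2 * z ^ 2)) ^ 2 / f0 := by
        rw [← hr2]; field_simp; ring
      rw [h1, div_le_iff₀ hf]
      nlinarith [hnn y z]
  · subst hf
    refine bin4 hpsd h0 a0 a1 a2 a3 a4 ?_
    intro x y z
    rw [H]
    have := (hq y z).2.2
    have hg : g0 * y ^ 3 + g1 * y ^ 2 * z + g2 * y * z ^ 2 + 0 * z ^ 3 = 0 :=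
      pow_eq_zero_iff (n := 2) (by norm_num) |>.mp (le_antisymm (this.trans_eq (by ring)) (sq_nonneg _))
    rw [hg]; ring

lemma sum_sq_pos {b c : ℝ} (hbc : b ≠ 0 ∨ c ≠ 0) : 0 < b ^ 2 + c ^ 2 := by
  rcases hbc with h | h
  · have := pow_pos (abs_pos.mpr h) 2; rw [sq_abs] at this; positivity
  · have := pow_pos (abs_pos.mpr h) 2; rw [sq_abs] at this; positivity

lemma caseC {T : R3} (hpsd : Psd T) (f0 f1 f2 g0 g1 g2 a0 a1 a2 : ℝ)
    (hf : ∀ y z : ℝ, (y ≠ 0 ∨ z ≠ 0) → 0 < f0 * y ^ 2 + f1 * y * z + f2 * z ^ 2)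
    (H : ∀ x y z : ℝ, eval ![x, y, z] T = x ^ 2 * (f0 * y ^ 2 + f1 * y * z + f2 * z ^ 2) +
        2 * x * (z * (g0 * y ^ 2 + g1 * y * z + g2 * z ^ 2)) +
      z ^ 2 * (a0 * y ^ 2 + a1 * y * z + a2 * z ^ 2)) : Dom 2 T := by
  have hf' : ∀ p : ℝ × ℝ, p ≠ 0 → 0 < f0 * p.1 ^ 2 + f1 * p.1 * p.2 + f2 * p.2 ^ 2 := by
    intro p hp
    apply hf
    by_contra h
    push Not at h
    exact hp (Prod.ext h.1 h.2)
  have hq := fun y z : ℝ => quad_nonneg (f := f0 * y ^ 2 + f1 * y * z + f2 * z ^ 2)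
    (g := z * (g0 * y ^ 2 + g1 * y * z + g2 * z ^ 2))
    (h := z ^ 2 * (a0 * y ^ 2 + a1 * y * z + a2 * z ^ 2))
    (fun x => by rw [← H]; exact hpsd _)
  have hD : ∀ y z : ℝ, 0 ≤ (f0 * y ^ 2 + f1 * y * z + f2 * z ^ 2) * (a0 * y ^ 2 + a1 * y * z + a2 * z ^ 2)
      - (g0 * y ^ 2 + g1 * y * z + g2 * z ^ 2) ^ 2 := by
    have key : ∀ y z : ℝ, z ≠ 0 → 0 ≤ (f0 * y ^ 2 + f1 * y * z + f2 * z ^ 2) * (a0 * y ^ 2 + a1 * y * z + a2 * z ^ 2)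
      - (g0 * y ^ 2 + g1 * y * z + g2 * z ^ 2) ^ 2 := by
      intro y z hz
      have := (hq y z).2.2
      have hz2 : 0 < z ^ 2 := by positivity
      refine nonneg_of_mul_nonneg_right ((sub_nonneg.mpr this).trans_eq ?_) hz2
      ring
    intro y z
    by_cases hz : z = 0
    · subst hz
      exact nonneg_at (F := fun z => (f0 * y ^ 2 + f1 * y * z + f2 * z ^ 2) * (a0 * y ^ 2 + a1 * y * z + a2 * z ^ 2)
      - (g0 * y ^ 2 + g1 * y * z + g2 * z ^ 2) ^ 2) (by fun_prop) 0 (fun z hz => key y z hz)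
    · exact key y z hz
  by_cases hz : ∃ b c : ℝ, (b ≠ 0 ∨ c ≠ 0) ∧ (f0 * b ^ 2 + f1 * b * c + f2 * c ^ 2) * (a0 * b ^ 2 + a1 * b * c + a2 * c ^ 2)
      - (g0 * b ^ 2 + g1 * b * c + g2 * c ^ 2) ^ 2 = 0
  · obtain ⟨b, c, hbc, hz⟩ := hz
    have hN := sum_sq_pos hbc
    set N := b ^ 2 + c ^ 2 with hNdef
    have hfb := hf b c hbc
    set fb := f0 * b ^ 2 + f1 * b * c + f2 * c ^ 2 with hfbdef
    obtain ⟨α, hα⟩ : ∃ α : ℝ, (g0 * b ^ 2 + g1 * b * c + g2 * c ^ 2) + α * fb = 0 :=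
      ⟨-(g0 * b ^ 2 + g1 * b * c + g2 * c ^ 2) / fb, by field_simp; ring⟩
    -- shifted data
    obtain ⟨G0, hG0⟩ : ∃ G0, G0 = g0 + α * f0 := ⟨_, rfl⟩
    obtain ⟨G1, hG1⟩ : ∃ G0, G0 = g1 + α * f1 := ⟨_, rfl⟩
    obtain ⟨G2, hG2⟩ : ∃ G0, G0 = g2 + α * f2 := ⟨_, rfl⟩
    obtain ⟨q0, hq0⟩ : ∃ G0, G0 = a0 + 2 * α * g0 + α ^ 2 * f0 := ⟨_, rfl⟩
    obtain ⟨q1, hq1⟩ : ∃ G0, G0 = a1 + 2 * α * g1 + α ^ 2 * f1 := ⟨_, rfl⟩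
    obtain ⟨q2, hq2⟩ : ∃ G0, G0 = a2 + 2 * α * g2 + α ^ 2 * f2 := ⟨_, rfl⟩
    have hGb : G0 * b ^ 2 + G1 * b * c + G2 * c ^ 2 = 0 := by
      rw [hG0, hG1, hG2, ← hα, hfbdef]; ring
    have hqb : q0 * b ^ 2 + q1 * b * c + q2 * c ^ 2 = 0 := by
      have : fb * (q0 * b ^ 2 + q1 * b * c + q2 * c ^ 2) = 0 := by
        rw [hq0, hq1, hq2]
        have h2 : g0 * b ^ 2 + g1 * b * c + g2 * c ^ 2 = - α * fb := by linarith
        rw [h2] at hz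
        linear_combination hz + 2 * α * fb * h2 - fb * α ^ 2 * hfbdef
      exact (mul_eq_zero.mp this).resolve_left hfb.ne'
    have hD' : ∀ y z : ℝ, 0 ≤ (f0 * y ^ 2 + f1 * y * z + f2 * z ^ 2) * (q0 * y ^ 2 + q1 * y * z + q2 * z ^ 2)
      - (G0 * y ^ 2 + G1 * y * z + G2 * z ^ 2) ^ 2 := by
      intro y z
      refine (hD y z).trans_eq ?_
      rw [hG0, hG1, hG2, hq0, hq1, hq2]
      ring
    have hH : ∀ x y z : ℝ, eval ![x, y, z] T = (x - α * z) ^ 2 * (f0 * y ^ 2 + f1 * y * z + f2 * z ^ 2) +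
        2 * (x - α * z) * (z * (G0 * y ^ 2 + G1 * y * z + G2 * z ^ 2)) +
      z ^ 2 * (q0 * y ^ 2 + q1 * y * z + q2 * z ^ 2) := by
      intro x y z
      rw [H, hG0, hG1, hG2, hq0, hq1, hq2]
      ring
    have hqnn : ∀ y z : ℝ, 0 ≤ q0 * y ^ 2 + q1 * y * z + q2 * z ^ 2 := by
      intro y z
      by_cases h : y ≠ 0 ∨ z ≠ 0
      · refine nonneg_of_mul_nonneg_right ?_ (hf y z h)
        nlinarith [hD' y z, sq_nonneg (G0 * y ^ 2 + G1 * y * z + G2 * z ^ 2)]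
      · push Not at h
        rw [h.1, h.2]; simp
    have e1 : 2 * q0 * b + q1 * c = 0 := lin_coeff_zero (β := q0) (γ := 0) (δ := 0) (fun t => by
      refine (hqnn (b + t) c).trans_eq ?_
      linear_combination hqb)
    have e2 : q1 * b + 2 * q2 * c = 0 := lin_coeff_zero (β := q2) (γ := 0) (δ := 0) (fun t => by
      refine (hqnn b (c + t)).trans_eq ?_
      linear_combination hqb)
    obtain ⟨lam, hlam⟩ : ∃ lam, lam = (q0 + q2) / N := ⟨_, rfl⟩
    have hlam' : lam * N = q0 + q2 := by rw [hlam]; field_simp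
    have hq0' : q0 = lam * c ^ 2 := by
      have : N * (q0 - lam * c ^ 2) = 0 := by
        rw [hNdef] at *; linear_combination (b / 2) * e1 - (c / 2) * e2 - c ^ 2 * hlam'
      linarith [(mul_eq_zero.mp this).resolve_left hN.ne']
    have hq1' : q1 = - 2 * lam * b * c := by
      have : N * (q1 + 2 * lam * b * c) = 0 := by
        rw [hNdef] at *; linear_combination c * e1 + b * e2 + 2 * b * c * hlam'
      linarith [(mul_eq_zero.mp this).resolve_left hN.ne']
    have hq2' : q2 = lam * b ^ 2 := by
      have : N * (q2 - lam * b ^ 2) = 0 := by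
        rw [hNdef] at *; linear_combination -(b / 2) * e1 + (c / 2) * e2 - b ^ 2 * hlam'
      linarith [(mul_eq_zero.mp this).resolve_left hN.ne']
    have hlam0 : 0 ≤ lam := by
      rw [hlam]
      have h1 := hqnn 1 0
      have h2 := hqnn 0 1
      simp at h1 h2
      positivity
    obtain ⟨n0, hn0⟩ : ∃ n0, n0 = (c * G0 - b * G1 - c * G2) / N := ⟨_, rfl⟩
    obtain ⟨n1, hn1⟩ : ∃ n1, n1 = (c * G1 + b * G0 - b * G2) / N := ⟨_, rfl⟩
    have hn0' : n0 * N = c * G0 - b * G1 - c * G2 := by rw [hn0]; field_simp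
    have hn1' : n1 * N = c * G1 + b * G0 - b * G2 := by rw [hn1]; field_simp
    have hmn : ∀ y z : ℝ, G0 * y ^ 2 + G1 * y * z + G2 * z ^ 2 = (c * y - b * z) * (n0 * y + n1 * z) := by
      intro y z
      have : N * ((G0 * y ^ 2 + G1 * y * z + G2 * z ^ 2) - (c * y - b * z) * (n0 * y + n1 * z)) = 0 := by
        rw [hNdef] at *
        linear_combination (y ^ 2 + z ^ 2) * hGb - (c * y - b * z) * y * hn0' - (c * y - b * z) * z * hn1'
      linarith [(mul_eq_zero.mp this).resolve_left hN.ne']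
    rcases hlam0.lt_or_eq with hl | hl
    · have hnn : ∀ y z : ℝ, 0 ≤ lam * (f0 * y ^ 2 + f1 * y * z + f2 * z ^ 2) - (n0 * y + n1 * z) ^ 2 := by
        have key : ∀ y z : ℝ, c * y - b * z ≠ 0 → 0 ≤ lam * (f0 * y ^ 2 + f1 * y * z + f2 * z ^ 2) - (n0 * y + n1 * z) ^ 2 := by
          intro y z hm
          have := hD' y z
          have hm2 : 0 < (c * y - b * z) ^ 2 := by positivity
          refine nonneg_of_mul_nonneg_right (this.trans_eq ?_) hm2
          rw [hmn, hq0', hq1', hq2']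
          ring
        intro y z
        by_cases hm : c * y - b * z = 0
        · have := nonneg_at (F := fun s => lam * (f0 * (y + s * c) ^ 2 + f1 * (y + s * c) * (z - s * b) + f2 * (z - s * b) ^ 2) - (n0 * (y + s * c) + n1 * (z - s * b)) ^ 2)
            (by fun_prop) 0 (fun s hs => key _ _ (by
              have : c * (y + s * c) - b * (z - s * b) = s * N := by rw [hNdef]; linear_combination hm
              rw [this]; positivity))
          simpa using this
        · exact key y z hm
      set r := Real.sqrt lam with hr
      have hrpos : 0 < r := Real.sqrt_pos.mpr hl
      have hr2 : r ^ 2 = lam := Real.sq_sqrt hl.le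
      refine mkDom 0 (n0 / r) (n1 / r) 0 (r * c - α * n0 / r) (- r * b - α * n1 / r) ?_ ?_
      · by_contra hcon
        push Not at hcon
        have e1 := hcon 1 1 0
        have e2 := hcon 1 0 1
        have e3 := hcon 0 0 1
        have e4 := hcon 0 1 1
        simp only [zero_mul, mul_zero, one_mul, mul_one, one_pow, zero_add, add_zero, ne_eq, OfNat.ofNat_ne_zero, not_false_eq_true, zero_pow] at e1 e2 e3 e4
        have e5 : n1 / r = 0 := by linarith
        have e1' : n0 = 0 := by rcases div_eq_zero_iff.mp e1 with h | h; exact h; exact absurd h hrpos.ne'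
        have e5' : n1 = 0 := by rcases div_eq_zero_iff.mp e5 with h | h; exact h; exact absurd h hrpos.ne'
        rw [e1', e5'] at e4
        rw [e5'] at e3
        simp only [mul_zero, zero_div, sub_zero] at e3 e4
        have hb : b = 0 := by
          have : r * b = 0 := by linarith
          exact (mul_eq_zero.mp this).resolve_left hrpos.ne'
        have hc : c = 0 := by
          have : r * c = 0 := by linarith
          exact (mul_eq_zero.mp this).resolve_left hrpos.ne'
        rcases hbc with h | h <;> contradiction
      · intro x y z
        have h1 : (0 * x ^ 2 + x * (n0 / r * y + n1 / r * z) + (0 * y ^ 2 + (r * c - α * n0 / r) * y * z + (- r * b - α * n1 / r) * z ^ 2)) ^ 2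
          = (lam * z * (c * y - b * z) + (x - α * z) * (n0 * y + n1 * z)) ^ 2 / lam := by
          rw [← hr2]; field_simp; ring
        rw [h1, div_le_iff₀ hl, hH, hmn, hq0', hq1', hq2']
        have := mul_nonneg (sq_nonneg (x - α * z)) (hnn y z)
        linarith
    · rw [← hl] at hq0' hq1' hq2'
      have hG : ∀ y z : ℝ, G0 * y ^ 2 + G1 * y * z + G2 * z ^ 2 = 0 := by
        intro y z
        have := hD' y z
        rw [hq0', hq1', hq2'] at this
        refine pow_eq_zero_iff (n := 2) (by norm_num) |>.mp (le_antisymm ?_ (sq_nonneg _))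
        linarith
      obtain ⟨ε, hε, hd⟩ := compact_dom (E := ℝ × ℝ) (k := 2)
        (F := fun p => f0 * p.1 ^ 2 + f1 * p.1 * p.2 + f2 * p.2 ^ 2)
        (G := fun p => p.1 ^ 2) (by norm_num) (by fun_prop) (by fun_prop)
        (by intro t x; simp; ring) (by intro t x; simp; ring) hf'
      refine mkDom 0 (Real.sqrt ε) 0 0 (- α * Real.sqrt ε) 0 ⟨1, 1, 0, by simp; positivity⟩ ?_
      intro x y z
      rw [hH, hG, hq0', hq1', hq2']
      have h1 : (0 * x ^ 2 + x * (√ε * y + 0 * z) + (0 * y ^ 2 + -α * √ε * y * z + 0 * z ^ 2)) ^ 2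
        = (x - α * z) ^ 2 * ((√ε) ^ 2 * y ^ 2) := by ring
      rw [h1, Real.sq_sqrt hε.le]
      have := mul_le_mul_of_nonneg_left (hd (y, z)) (sq_nonneg (x - α * z))
      simp only at this
      linarith
  · push Not at hz
    obtain ⟨ε, hε, hd⟩ := compact_dom (E := ℝ × ℝ) (k := 4)
      (F := fun p => (f0 * p.1 ^ 2 + f1 * p.1 * p.2 + f2 * p.2 ^ 2) * (a0 * p.1 ^ 2 + a1 * p.1 * p.2 + a2 * p.2 ^ 2)
      - (g0 * p.1 ^ 2 + g1 * p.1 * p.2 + g2 * p.2 ^ 2) ^ 2)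
      (G := fun p => p.2 ^ 2 * (f0 * p.1 ^ 2 + f1 * p.1 * p.2 + f2 * p.2 ^ 2)) (by norm_num) (by fun_prop) (by fun_prop)
      (by intro t x; simp; ring) (by intro t x; simp; ring) (by
        intro x hx
        refine lt_of_le_of_ne (hD _ _) (Ne.symm (hz _ _ ?_))
        by_contra h
        push Not at h
        exact hx (Prod.ext h.1 h.2))
    refine mkDom 0 0 0 0 0 (Real.sqrt ε) ⟨0, 0, 1, by simp; positivity⟩ ?_
    intro x y z
    have h1 : (0 * x ^ 2 + x * (0 * y + 0 * z) + (0 * y ^ 2 + 0 * y * z + √ε * z ^ 2)) ^ 2 = (√ε) ^ 2 * z ^ 4 := by ring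
    rw [h1, Real.sq_sqrt hε.le, H]
    by_cases h : y ≠ 0 ∨ z ≠ 0
    · have hfp := hf y z h
      have h2 := mul_le_mul_of_nonneg_left (hd (y, z)) (sq_nonneg z)
      simp only at h2
      refine le_of_mul_le_mul_left ?_ hfp
      nlinarith [sq_nonneg (x * (f0 * y ^ 2 + f1 * y * z + f2 * z ^ 2) + z * (g0 * y ^ 2 + g1 * y * z + g2 * z ^ 2))]
    · push Not at h
      rw [h.1, h.2]; simp

lemma red {T : R3} (hT : T.IsHomogeneous 4) (hpsd : Psd T) (he : eval ![1, 0, 0] T = 0) :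
    ∃ f0 f1 f2 g0 g1 g2 g3 a0 a1 a2 a3 a4 : ℝ, ∀ x y z : ℝ, eval ![x, y, z] T =
      x ^ 2 * (f0 * y ^ 2 + f1 * y * z + f2 * z ^ 2) +
        2 * x * (g0 * y ^ 3 + g1 * y ^ 2 * z + g2 * y * z ^ 2 + g3 * z ^ 3) +
        (a0 * y ^ 4 + a1 * y ^ 3 * z + a2 * y ^ 2 * z ^ 2 + a3 * y * z ^ 3 + a4 * z ^ 4) := by
  obtain ⟨a, b, c, f0, f1, f2, g0, g1, g2, g3, a0, a1, a2, a3, a4, H⟩ := hom4 hT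
  have ha : a = 0 := by rw [H] at he; simpa using he
  subst ha
  have hb : b = 0 := lin_coeff_zero (β := f0) (γ := 2 * g0) (δ := a0) (fun t => by
    have := hpsd ![1, t, 0]
    rw [H] at this
    refine this.trans_eq ?_; ring)
  have hc : c = 0 := lin_coeff_zero (β := f2) (γ := 2 * g3) (δ := a4) (fun t => by
    have := hpsd ![1, 0, t]
    rw [H] at this
    refine this.trans_eq ?_; ring)
  subst hb hc
  exact ⟨f0, f1, f2, g0, g1, g2, g3, a0, a1, a2, a3, a4, fun x y z => by rw [H]; ring⟩

lemma quart_e0 {T : R3} (hT : T.IsHomogeneous 4) (hpsd : Psd T) (h0 : T ≠ 0)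
    (he : eval ![1, 0, 0] T = 0) : Dom 2 T := by
  obtain ⟨f0, f1, f2, g0, g1, g2, g3, a0, a1, a2, a3, a4, H⟩ := red hT hpsd he
  have hq := fun y z : ℝ => quad_nonneg (f := f0 * y ^ 2 + f1 * y * z + f2 * z ^ 2)
    (g := g0 * y ^ 3 + g1 * y ^ 2 * z + g2 * y * z ^ 2 + g3 * z ^ 3)
    (h := a0 * y ^ 4 + a1 * y ^ 3 * z + a2 * y ^ 2 * z ^ 2 + a3 * y * z ^ 3 + a4 * z ^ 4)
    (fun x => by rw [← H]; exact hpsd _)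
  by_cases hA : ∃ b c : ℝ, (b ≠ 0 ∨ c ≠ 0) ∧ f0 * b ^ 2 + f1 * b * c + f2 * c ^ 2 = 0
  · obtain ⟨b, c, hbc, hz⟩ := hA
    have hN := sum_sq_pos hbc
    have hdet : (!![1, 0, 0; 0, c, b; 0, -b, c] : Matrix (Fin 3) (Fin 3) ℝ).det ≠ 0 := by
      rw [Matrix.det_fin_three]; simp; nlinarith
    apply dom_lsub _ hdet
    set T' := lsub !![1, 0, 0; 0, c, b; 0, -b, c] T with hT'
    have hp' : Psd T' := lsub_psd hpsd
    have h0' : T' ≠ 0 := lsub_ne hdet h0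
    have hev : ∀ x y z : ℝ, eval ![x, y, z] T' = eval ![x, c * y + b * z, -b * y + c * z] T := by
      intro x y z
      rw [hT', eval_lsub_mk]; simp
    obtain ⟨f0', f1', f2', g0', g1', g2', g3', a0', a1', a2', a3', a4', H'⟩ := red (lsub_hom _ hT) hp'
      (by rw [hev]; simpa using he)
    have hff : f2' = 0 := by
      have e1 := hev 1 0 1
      have e2 := hev (-1) 0 1
      have e3 := hev 0 0 1
      rw [H, H'] at e1 e2 e3
      simp at e1 e2 e3
      linarith
    subst hff
    have hq' := fun y z : ℝ => quad_nonneg (f := f0' * y ^ 2 + f1' * y * z + 0 * z ^ 2)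
      (g := g0' * y ^ 3 + g1' * y ^ 2 * z + g2' * y * z ^ 2 + g3' * z ^ 3)
      (h := a0' * y ^ 4 + a1' * y ^ 3 * z + a2' * y ^ 2 * z ^ 2 + a3' * y * z ^ 3 + a4' * z ^ 4)
      (fun x => by rw [← H']; exact hp' _)
    have hf1 : f1' = 0 := lin_coeff_zero (β := f0') (γ := 0) (δ := 0) (fun t =>
      (hq' t 1).1.trans_eq (by ring))
    subst hf1
    exact caseA hp' h0' f0' g0' g1' g2' g3' a0' a1' a2' a3' a4' (fun x y z => by rw [H']; ring)
  · push Not at hA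
    have hf : ∀ y z : ℝ, (y ≠ 0 ∨ z ≠ 0) → 0 < f0 * y ^ 2 + f1 * y * z + f2 * z ^ 2 := fun y z h =>
      lt_of_le_of_ne (hq y z).1 (Ne.symm (hA y z h))
    by_cases hD : ∃ b c : ℝ, (b ≠ 0 ∨ c ≠ 0) ∧ (f0 * b ^ 2 + f1 * b * c + f2 * c ^ 2) *
        (a0 * b ^ 4 + a1 * b ^ 3 * c + a2 * b ^ 2 * c ^ 2 + a3 * b * c ^ 3 + a4 * c ^ 4) -
        (g0 * b ^ 3 + g1 * b ^ 2 * c + g2 * b * c ^ 2 + g3 * c ^ 3) ^ 2 = 0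
    · obtain ⟨b, c, hbc, hz⟩ := hD
      have hN := sum_sq_pos hbc
      have hfb := hf b c hbc
      obtain ⟨α, hα⟩ : ∃ α : ℝ, (g0 * b ^ 3 + g1 * b ^ 2 * c + g2 * b * c ^ 2 + g3 * c ^ 3)
          + α * (f0 * b ^ 2 + f1 * b * c + f2 * c ^ 2) = 0 :=
        ⟨-(g0 * b ^ 3 + g1 * b ^ 2 * c + g2 * b * c ^ 2 + g3 * c ^ 3) / (f0 * b ^ 2 + f1 * b * c + f2 * c ^ 2),
          by rw [div_mul_cancel₀ _ hfb.ne']; ring⟩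
      have hdet : (!![1, α, 0; 0, b, -c; 0, c, b] : Matrix (Fin 3) (Fin 3) ℝ).det ≠ 0 := by
        rw [Matrix.det_fin_three]; simp; nlinarith
      apply dom_lsub _ hdet
      set T' := lsub !![1, α, 0; 0, b, -c; 0, c, b] T with hT'
      have hp' : Psd T' := lsub_psd hpsd
      have h0' : T' ≠ 0 := lsub_ne hdet h0
      have hev : ∀ x y z : ℝ, eval ![x, y, z] T' = eval ![x + α * y, b * y - c * z, c * y + b * z] T := by
        intro x y z
        rw [hT', eval_lsub_mk]; simp
        ring_nf
      obtain ⟨f0', f1', f2', g0', g1', g2', g3', a0', a1', a2', a3', a4', H'⟩ := red (lsub_hom _ hT) hp'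
        (by rw [hev]; simpa using he)
      have ha0 : a0' = 0 := by
        have e1 := hev 0 1 0
        rw [H, H'] at e1
        simp at e1
        rw [e1]
        have : (f0 * b ^ 2 + f1 * b * c + f2 * c ^ 2) * (α ^ 2 * (f0 * b ^ 2 + f1 * b * c + f2 * c ^ 2) +
          2 * α * (g0 * b ^ 3 + g1 * b ^ 2 * c + g2 * b * c ^ 2 + g3 * c ^ 3) +
          (a0 * b ^ 4 + a1 * b ^ 3 * c + a2 * b ^ 2 * c ^ 2 + a3 * b * c ^ 3 + a4 * c ^ 4)) = 0 := by
          linear_combination hz + ((g0 * b ^ 3 + g1 * b ^ 2 * c + g2 * b * c ^ 2 + g3 * c ^ 3)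
          + α * (f0 * b ^ 2 + f1 * b * c + f2 * c ^ 2)) * hα
        exact (mul_eq_zero.mp this).resolve_left hfb.ne'
      subst ha0
      have ha1 : a1' = 0 := lin_coeff_zero (β := a2') (γ := a3') (δ := a4') (fun t => by
        have := hp' ![0, 1, t]
        rw [H'] at this
        refine this.trans_eq ?_; ring)
      subst ha1
      have hg0 : 2 * g0' = 0 := lin_coeff_zero (β := f0') (γ := 0) (δ := 0) (fun t => by
        have := hp' ![t, 1, 0]
        rw [H'] at this
        refine this.trans_eq ?_; ring)
      have hg0' : g0' = 0 := by linarith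
      subst hg0'
      refine caseC hp' f0' f1' f2' g1' g2' g3' a2' a3' a4' ?_ (fun x y z => by rw [H']; ring)
      intro y z hyz
      have hff : f0' * y ^ 2 + f1' * y * z + f2' * z ^ 2 =
          f0 * (b * y - c * z) ^ 2 + f1 * (b * y - c * z) * (c * y + b * z) + f2 * (c * y + b * z) ^ 2 := by
        have e1 := hev 1 y z
        have e2 := hev (-1) y z
        have e3 := hev 0 y z
        rw [H, H'] at e1 e2 e3
        linear_combination (e1 + e2 - 2 * e3) / 2
      rw [hff]
      apply hf
      by_contra h
      push Not at h
      have h1 : (b ^ 2 + c ^ 2) * y = 0 := by linear_combination b * h.1 + c * h.2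
      have h2 : (b ^ 2 + c ^ 2) * z = 0 := by linear_combination b * h.2 - c * h.1
      have h1 := (mul_eq_zero.mp h1).resolve_left hN.ne'
      have h2 := (mul_eq_zero.mp h2).resolve_left hN.ne'
      rcases hyz with h | h <;> contradiction
    · push Not at hD
      obtain ⟨ε, hε, hd⟩ := compact_dom (E := ℝ × ℝ) (k := 6)
        (F := fun p => (f0 * p.1 ^ 2 + f1 * p.1 * p.2 + f2 * p.2 ^ 2) *
        (a0 * p.1 ^ 4 + a1 * p.1 ^ 3 * p.2 + a2 * p.1 ^ 2 * p.2 ^ 2 + a3 * p.1 * p.2 ^ 3 + a4 * p.2 ^ 4) -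
        (g0 * p.1 ^ 3 + g1 * p.1 ^ 2 * p.2 + g2 * p.1 * p.2 ^ 2 + g3 * p.2 ^ 3) ^ 2)
        (G := fun p => (f0 * p.1 ^ 2 + f1 * p.1 * p.2 + f2 * p.2 ^ 2) ^ 3) (by norm_num) (by fun_prop) (by fun_prop)
        (by intro t x; simp; ring) (by intro t x; simp; ring) (by
          intro x hx
          refine lt_of_le_of_ne (sub_nonneg.mpr (hq _ _).2.2) (Ne.symm (hD _ _ ?_))
          by_contra h
          push Not at h
          exact hx (Prod.ext h.1 h.2))
      refine mkDom 0 0 0 (Real.sqrt ε * f0) (Real.sqrt ε * f1) (Real.sqrt ε * f2) ⟨0, 1, 0, ?_⟩ ?_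
      · have := hf 1 0 (by simp)
        simp at this
        simp
        exact ⟨hε.le.lt_of_ne (Ne.symm hε.ne') |>.ne' |> fun h => by positivity, this.ne'⟩
      intro x y z
      have h1 : (0 * x ^ 2 + x * (0 * y + 0 * z) + (√ε * f0 * y ^ 2 + √ε * f1 * y * z + √ε * f2 * z ^ 2)) ^ 2 = (√ε) ^ 2 * (f0 * y ^ 2 + f1 * y * z + f2 * z ^ 2) ^ 2 := by ring
      rw [h1, Real.sq_sqrt hε.le, H]
      by_cases h : y ≠ 0 ∨ z ≠ 0
      · have hfp := hf y z h
        have h2 := (hd (y, z))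
        simp only at h2
        refine le_of_mul_le_mul_left ?_ hfp
        nlinarith [sq_nonneg (x * (f0 * y ^ 2 + f1 * y * z + f2 * z ^ 2) + (g0 * y ^ 3 + g1 * y ^ 2 * z + g2 * y * z ^ 2 + g3 * z ^ 3))]
      · push Not at h
        rw [h.1, h.2]; simp

lemma quart_dom {T : R3} (hT : T.IsHomogeneous 4) (hpsd : Psd T) (h0 : T ≠ 0) : Dom 2 T := by
  by_cases hz : ∃ P : V3, P ≠ 0 ∧ eval P T = 0
  · obtain ⟨P, hP0, hP⟩ := hz
    have key : ∀ A : Matrix (Fin 3) (Fin 3) ℝ, A.det ≠ 0 → A.mulVec ![1, 0, 0] = P → Dom 2 T := by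
      intro A hA hAP
      apply dom_lsub A hA
      exact quart_e0 (lsub_hom _ hT) (lsub_psd hpsd) (lsub_ne hA h0) (by rw [eval_lsub, hAP, hP])
    have : P 0 ≠ 0 ∨ P 1 ≠ 0 ∨ P 2 ≠ 0 := by
      by_contra h
      push Not at h
      apply hP0
      rw [vec_eta P, h.1, h.2.1, h.2.2]
      ext i; fin_cases i <;> rfl
    rcases this with h | h | h
    · refine key !![P 0, 0, 0; P 1, 1, 0; P 2, 0, 1] (by rw [Matrix.det_fin_three]; simpa using h) ?_
      ext i; fin_cases i <;> simp [Matrix.mulVec, dotProduct, Fin.sum_univ_three]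
    · refine key !![P 0, 1, 0; P 1, 0, 0; P 2, 0, 1] (by rw [Matrix.det_fin_three]; simpa using h) ?_
      ext i; fin_cases i <;> simp [Matrix.mulVec, dotProduct, Fin.sum_univ_three]
    · refine key !![P 0, 1, 0; P 1, 0, 1; P 2, 0, 0] (by rw [Matrix.det_fin_three]; simpa using h) ?_
      ext i; fin_cases i <;> simp [Matrix.mulVec, dotProduct, Fin.sum_univ_three]
  · push Not at hz
    obtain ⟨ε, hε, hd⟩ := compact_dom (E := V3) (k := 4) (F := fun v => eval v T)
      (G := fun v => v 0 ^ 4) (by norm_num) (MvPolynomial.continuous_eval T) (by fun_prop)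
      (fun t x => eval_smul_hom hT t x) (by intro t x; simp; ring)
      (fun x hx => lt_of_le_of_ne (hpsd x) (Ne.symm (hz x hx)))
    refine mkDom (Real.sqrt ε) 0 0 0 0 0 ⟨1, 0, 0, by simp; positivity⟩ ?_
    intro x y z
    have h1 : (√ε * x ^ 2 + x * (0 * y + 0 * z) + (0 * y ^ 2 + 0 * y * z + 0 * z ^ 2)) ^ 2 = (√ε) ^ 2 * x ^ 4 := by ring
    rw [h1, Real.sq_sqrt hε.le]
    exact hd ![x, y, z]

lemma bezout_pts {ι : Type*} [Fintype ι] {d e : ℕ} {f g : R3} (hf : f.IsHomogeneous d)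
    (hg : g.IsHomogeneous e) (hf0 : f ≠ 0) (hg0 : g ≠ 0) (hc : IsRelPrime f g)
    (P : ι → V3) (hP0 : ∀ i, P i ≠ 0)
    (hP : ∀ i j, i ≠ j → LinearIndependent ℝ ![P i, P j])
    (hfP : ∀ i, eval (P i) f = 0) (hgP : ∀ i, eval (P i) g = 0) : Fintype.card ι ≤ d * e := by
  have key : ∀ {h : R3} {n : ℕ}, h.IsHomogeneous n → (∀ i, eval (P i) h = 0) →
      ∀ i, ∀ v ∈ Submodule.span ℝ {P i}, dd h (P i) v = 0 := by
    intro h n hh h0 i v hv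
    obtain ⟨c, rfl⟩ := Submodule.mem_span_singleton.mp hv
    have := (ddL h (P i)).map_smul c (P i)
    simp only [ddL_apply] at this
    rw [this, dd_euler hh, h0]; simp
  have := bezout hf hg hf0 hg0 hc P hP0 hP (fun i => Submodule.span ℝ {P i}) hfP hgP
    (key hf hfP) (key hg hgP)
  simpa [finrank_span_singleton (hP0 _)] using this

lemma sign_dvd {p r : R3} {n m : ℕ} (hirr : Irreducible p) (hp : p.IsHomogeneous n)
    (hr : r.IsHomogeneous m) {u v : V3} (hu : 0 < eval u p) (hv : eval v p < 0)
    (H : ∀ x, 0 ≤ eval x p * eval x r) : p ∣ r := by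
  by_contra hnd
  have hr0 : r ≠ 0 := by rintro rfl; exact hnd (dvd_zero _)
  obtain ⟨w, hw0, hw, hwp, hwr⟩ := signpts hp hu hv (n * m + 1)
  have := bezout_pts hp hr hirr.ne_zero hr0 (hirr.isRelPrime_iff_not_dvd.mpr hnd) w hw0 hw hwp (hwr r H)
  simp at this

lemma psd_of_dense {p r : R3} (hp : p ≠ 0) (h : ∀ x, eval x p ≠ 0 → 0 ≤ eval x r) : Psd r := by
  intro u
  obtain ⟨w, hw⟩ := exists_eval_ne hp
  let L := linePoly p u (w - u)
  have hL : L ≠ 0 := by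
    intro h0
    have := linePoly_eval p u (w - u) 1
    rw [show linePoly p u (w - u) = 0 from h0] at this
    simp at this
    exact hw this.symm
  have hfin : {t | L.IsRoot t}.Finite := Polynomial.finite_setOfPred_isRoot hL
  have hd : Dense ({t | L.IsRoot t}ᶜ : Set ℝ) := hfin.countable.dense_compl ℝ
  have hcont : Continuous (fun t : ℝ => eval (u + t • (w - u)) r) :=
    (MvPolynomial.continuous_eval r).comp (by fun_prop)
  have hcl : IsClosed {t : ℝ | 0 ≤ eval (u + t • (w - u)) r} := isClosed_le continuous_const hcont
  have hsub : closure ({t | L.IsRoot t}ᶜ : Set ℝ) ⊆ {t : ℝ | 0 ≤ eval (u + t • (w - u)) r} := by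
    refine closure_minimal (fun t ht => h _ (fun h0 => ht ?_)) hcl
    show L.eval t = 0
    rw [← h0]
    exact linePoly_eval p u (w - u) t
  rw [hd.closure_eq] at hsub
  have := hsub (Set.mem_univ 0)
  simpa using this

lemma sos_sq_smul {c : ℝ} (hc : 0 ≤ c) {p : R3} (hp : Sos p) : Sos (c • p) := by
  obtain ⟨n, h, rfl⟩ := hp
  refine ⟨n, fun i => C (Real.sqrt c) * h i, ?_⟩
  rw [Finset.smul_sum]
  refine Finset.sum_congr rfl (fun i _ => ?_)
  rw [mul_pow, ← C_pow, Real.sq_sqrt hc, smul_eq_C_mul]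

lemma sos_sq (t : R3) : Sos (t ^ 2) := ⟨1, fun _ => t, by simp⟩

lemma sos_add {a b : R3} (ha : Sos a) (hb : Sos b) : Sos (a + b) := by
  obtain ⟨n, h, rfl⟩ := ha
  obtain ⟨m, k, rfl⟩ := hb
  refine ⟨n + m, Fin.append h k, ?_⟩
  rw [Fin.sum_univ_add]
  simp

lemma ext_noDom {q : R3} (hq : IsExtremeSextic q) : ¬ Dom 3 q := by
  rintro ⟨t, ht, ht0, H⟩
  obtain ⟨hh, hpsd, hns, hext⟩ := hq
  have ht2 : (t ^ 2).IsHomogeneous 6 := ht.pow 2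
  obtain ⟨⟨c, hc, hc'⟩, _⟩ := hext (t ^ 2) (q - t ^ 2) ht2 (hh.sub ht2) (fun u => by simp; positivity)
    (fun u => by simpa using H u) (by ring)
  have hc0 : c ≠ 0 := by
    rintro rfl
    rw [zero_smul] at hc'
    exact ht0 (pow_eq_zero_iff (by norm_num) |>.mp hc')
  apply hns
  have : q = c⁻¹ • t ^ 2 := by rw [hc', smul_smul, inv_mul_cancel₀ hc0, one_smul]
  rw [this]
  exact sos_sq_smul (inv_nonneg.mpr hc) (sos_sq t)

lemma dom_zero {p : R3} (hp : p.IsHomogeneous 0) (hpsd : Psd p) (h0 : p ≠ 0) : Dom 0 p := by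
  rw [← totalDegree_zero_iff_isHomogeneous, totalDegree_eq_zero_iff_eq_C] at hp
  obtain ⟨a, ha⟩ : ∃ a, p = C a := ⟨_, hp⟩
  subst ha
  have ha0 : 0 ≤ a := by simpa using hpsd 0
  have ha1 : a ≠ 0 := by rintro rfl; simp at h0
  refine ⟨C (Real.sqrt a), isHomogeneous_C _ _, ?_, ?_⟩
  · simp; intro h; exact ha1 ((Real.sqrt_eq_zero ha0).mp h)
  · intro v; simp [Real.sq_sqrt ha0]

lemma dom_mul {a b : ℕ} {p r : R3} (hp : Dom a p) (hr : Dom b r) : Dom (a + b) (p * r) := by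
  obtain ⟨s, hs, hs0, Hs⟩ := hp
  obtain ⟨t, ht, ht0, Ht⟩ := hr
  refine ⟨s * t, hs.mul ht, mul_ne_zero hs0 ht0, fun v => ?_⟩
  rw [map_mul, map_mul, mul_pow]
  exact mul_le_mul (Hs v) (Ht v) (sq_nonneg _) ((sq_nonneg _).trans (Hs v))

lemma ext_ne {q : R3} (hq : IsExtremeSextic q) : q ≠ 0 := by
  rintro rfl
  exact hq.2.2.1 ⟨0, Fin.elim0, by simp⟩

lemma ext_not_dvd {q : R3} (hq : IsExtremeSextic q) {p : R3} {k : ℕ} (hk1 : 1 ≤ k) (hk3 : k ≤ 3)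
    (hp : p.IsHomogeneous k) (hirr : Irreducible p) : ¬ p ∣ q := by
  rintro ⟨r, hr⟩
  have hq0 := ext_ne hq
  have hp0 := hirr.ne_zero
  have hr0 : r ≠ 0 := by rintro rfl; simp at hr; exact hq0 hr
  have hrh : r.IsHomogeneous (6 - k) := (isHomogeneous_of_mul_right (hr ▸ hq.1) hp (hr ▸ hq0)).2
  have Hnn : ∀ x, 0 ≤ eval x p * eval x r := fun x => by rw [← map_mul, ← hr]; exact hq.2.1 x
  by_cases hs : (∃ u, 0 < eval u p) ∧ ∃ v, eval v p < 0
  · obtain ⟨⟨u, hu⟩, v, hv⟩ := hs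
    obtain ⟨r', hr'⟩ := sign_dvd hirr hp hrh hu hv Hnn
    have hr'0 : r' ≠ 0 := by rintro rfl; simp at hr'; exact hr0 hr'
    have hr'h : r'.IsHomogeneous (6 - k - k) := (isHomogeneous_of_mul_right (hr' ▸ hrh) hp (hr' ▸ hr0)).2
    have hpsd : Psd r' := psd_of_dense hp0 (fun x hx => by
      have := Hnn x
      rw [hr', map_mul] at this
      have h2 : 0 < eval x p ^ 2 := by positivity
      refine nonneg_of_mul_nonneg_right (this.trans_eq ?_) h2
      ring)
    have hd2 : Dom (k + 0) (p ^ 2 * C 1) := dom_mul ⟨p, hp, hp0, fun v => by simp⟩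
      (dom_zero (isHomogeneous_C _ _) (fun u => by simp) (by simp))
    have hqe : q = p ^ 2 * C 1 * r' := by rw [hr, hr']; simp; ring
    apply ext_noDom hq
    rw [hqe]
    interval_cases k
    · exact dom_mul hd2 (quart_dom hr'h hpsd hr'0)
    · exact dom_mul hd2 (quad_dom hr'h hpsd hr'0)
    · exact dom_mul hd2 (dom_zero hr'h hpsd hr'0)
  · have hkeven : k = 2 := by
      by_contra hk2
      apply hs
      have hodd : Odd k := by
        have : k = 1 ∨ k = 3 := by omega
        rcases this with rfl | rfl <;> decide
      obtain ⟨w, hw⟩ := exists_eval_ne hp0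
      have hneg : eval (-w) p = - eval w p := by
        have := eval_smul_hom hp (-1) w
        rw [hodd.neg_one_pow] at this
        simpa using this
      rcases lt_or_gt_of_ne hw with h | h
      · exact ⟨⟨-w, by rw [hneg]; linarith⟩, w, h⟩
      · exact ⟨⟨w, h⟩, -w, by rw [hneg]; linarith⟩
    subst hkeven
    have key : ∀ p' r' : R3, p'.IsHomogeneous 2 → r'.IsHomogeneous 4 → p' ≠ 0 → r' ≠ 0 →
        q = p' * r' → Psd p' → False := by
      intro p' r' hp' hr' hp'0 hr'0 he hpsd
      have hpsd' : Psd r' := psd_of_dense hp'0 (fun x hx => by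
        have h1 : 0 < eval x p' := lt_of_le_of_ne (hpsd x) (Ne.symm hx)
        refine nonneg_of_mul_nonneg_right ?_ h1
        rw [← map_mul, ← he]; exact hq.2.1 x)
      apply ext_noDom hq
      rw [he]
      exact dom_mul (quad_dom hp' hpsd hp'0) (quart_dom hr' hpsd' hr'0)
    by_cases h1 : ∃ u, 0 < eval u p
    · refine key p r hp hrh hp0 hr0 hr (fun u => ?_)
      by_contra h2
      exact hs ⟨h1, u, not_le.mp h2⟩
    · refine key (-p) (-r) hp.neg hrh.neg (neg_ne_zero.mpr hp0) (neg_ne_zero.mpr hr0) (by rw [hr]; ring) (fun u => ?_)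
      push Not at h1
      have := h1 u
      simpa using this

lemma isUnit_of_hom0 {p : R3} (hp : p.IsHomogeneous 0) (h0 : p ≠ 0) : IsUnit p := by
  rw [← totalDegree_zero_iff_isHomogeneous, totalDegree_eq_zero_iff_eq_C] at hp
  rw [hp] at h0 ⊢
  exact (isUnit_iff_ne_zero.mpr (by rintro h; rw [h] at h0; simp at h0)).map C

lemma ext_relPrime {q : R3} (hq : IsExtremeSextic q) {f : R3} {n : ℕ} (hn : n ≤ 3)
    (hf : f.IsHomogeneous n) (hf0 : f ≠ 0) : IsRelPrime f q := by
  intro d hdf hdq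
  by_contra hu
  have hd0 : d ≠ 0 := by rintro rfl; exact hf0 (zero_dvd_iff.mp hdf)
  obtain ⟨p, hirr, hpd⟩ := WfDvdMonoid.exists_irreducible_factor hu hd0
  obtain ⟨g, hg⟩ := hpd.trans hdf
  obtain ⟨a, b, ha, hb, hab⟩ := isHomogeneous_of_mul (hg ▸ hf) (hg ▸ hf0)
  have ha1 : 1 ≤ a := by
    by_contra h
    have : a = 0 := by omega
    subst this
    exact hirr.not_isUnit (isUnit_of_hom0 ha hirr.ne_zero)
  exact ext_not_dvd hq ha1 (by omega) ha hirr (hpd.trans hdq)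

lemma finrank_ker_dd (f : R3) (u : V3) : 2 ≤ Module.finrank ℝ (LinearMap.ker (ddL f u)) := by
  have h1 := LinearMap.finrank_range_add_finrank_ker (ddL f u)
  have h2 : Module.finrank ℝ (LinearMap.range (ddL f u)) ≤ 1 := by
    simpa using Submodule.finrank_le (LinearMap.range (ddL f u))
  have h3 : Module.finrank ℝ V3 = 3 := by simp
  omega

lemma count2 {ι : Type*} [Fintype ι] {d e : ℕ} {f g : R3} (hf : f.IsHomogeneous d)
    (hg : g.IsHomogeneous e) (hf0 : f ≠ 0) (hg0 : g ≠ 0) (hc : IsRelPrime f g)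
    (P : ι → V3) (hP0 : ∀ i, P i ≠ 0)
    (hP : ∀ i j, i ≠ j → LinearIndependent ℝ ![P i, P j])
    (hfP : ∀ i, eval (P i) f = 0) (hgP : ∀ i, eval (P i) g = 0)
    (hgV : ∀ i v, dd g (P i) v = 0) :
    2 * Fintype.card ι ≤ d * e := by
  have := bezout hf hg hf0 hg0 hc P hP0 hP (fun i => LinearMap.ker (ddL f (P i))) hfP hgP
    (fun i v hv => by simpa using hv) (fun i v _ => hgV i v)
  refine le_trans ?_ this
  have h2 : ∑ _i : ι, 2 ≤ ∑ i, Module.finrank ℝ (LinearMap.ker (ddL f (P i))) :=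
    Finset.sum_le_sum (fun i _ => finrank_ker_dd f (P i))
  simpa [mul_comm] using h2

/-- extended family of points -/
def optPts {ι : Type*} (P : ι → V3) (p : V3) : Option ι → V3
  | none => p
  | some i => P i

lemma optPts_indep {ι : Type*} {P : ι → V3} {p : V3}
    (hP : ∀ i j, i ≠ j → LinearIndependent ℝ ![P i, P j])
    (hp : ∀ i, LinearIndependent ℝ ![p, P i]) :
    ∀ i j, i ≠ j → LinearIndependent ℝ ![optPts P p i, optPts P p j] := by
  rintro (_ | i) (_ | j) hij
  · exact absurd rfl hij
  · exact hp j
  · exact (LinearIndependent.pair_symm_iff).mp (hp i)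
  · exact hP i j (fun h => hij (by rw [h]))

lemma count2' {ι : Type*} [Fintype ι] {d e : ℕ} {f g : R3} (hf : f.IsHomogeneous d)
    (hg : g.IsHomogeneous e) (hf0 : f ≠ 0) (hg0 : g ≠ 0) (hc : IsRelPrime f g)
    (P : ι → V3) (hP0 : ∀ i, P i ≠ 0)
    (hP : ∀ i j, i ≠ j → LinearIndependent ℝ ![P i, P j])
    (hfP : ∀ i, eval (P i) f = 0) (hgP : ∀ i, eval (P i) g = 0)
    (hgV : ∀ i v, dd g (P i) v = 0)
    {p : V3} (hp0 : p ≠ 0) (hp : ∀ i, LinearIndependent ℝ ![p, P i])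
    (hfp : eval p f = 0) (hgp : eval p g = 0) :
    2 * Fintype.card ι + 1 ≤ d * e := by
  have key : ∀ {h : R3} {n : ℕ}, h.IsHomogeneous n → eval p h = 0 →
      ∀ v ∈ Submodule.span ℝ {p}, dd h p v = 0 := by
    intro h n hh h0 v hv
    obtain ⟨c, rfl⟩ := Submodule.mem_span_singleton.mp hv
    have := (ddL h p).map_smul c p
    simp only [ddL_apply] at this
    rw [this, dd_euler hh, h0]; simp
  let V : Option ι → Submodule ℝ V3 := fun o => match o with
    | none => Submodule.span ℝ {p}
    | some i => LinearMap.ker (ddL f (P i))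
  have := bezout hf hg hf0 hg0 hc (optPts P p) (by rintro (_ | i); exact hp0; exact hP0 i)
    (optPts_indep hP hp) V (by rintro (_ | i); exact hfp; exact hfP i)
    (by rintro (_ | i); exact hgp; exact hgP i)
    (by
      rintro (_ | i) v hv
      · exact key hf hfp v hv
      · have hv' : v ∈ LinearMap.ker (ddL f (P i)) := hv
        simpa [optPts] using hv')
    (by
      rintro (_ | i) v hv
      · exact key hg hgp v hv
      · exact hgV i v)
  rw [Fintype.sum_option] at this
  refine le_trans ?_ this
  have h1 : Module.finrank ℝ (V none) = 1 := finrank_span_singleton hp0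
  have h2 : ∑ _i : ι, 2 ≤ ∑ i, Module.finrank ℝ (V (some i)) :=
    Finset.sum_le_sum (fun i _ => finrank_ker_dd f (P i))
  rw [h1]
  have h3 : ∑ _i : ι, 2 = 2 * Fintype.card ι := by simp [mul_comm]
  omega

/-- A nine point configuration on which an extreme form vanishes. -/
structure Conf (P : Fin 9 → V3) (q : R3) : Prop where
  h0 : ∀ i, P i ≠ 0
  hP : ∀ i j, i ≠ j → LinearIndependent ℝ ![P i, P j]
  hq : IsExtremeSextic q
  hv : ∀ i, eval (P i) q = 0

lemma Conf.dd {P : Fin 9 → V3} {q : R3} (c : Conf P q) : ∀ i v, dd q (P i) v = 0 :=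
  fun i v => psd_dd c.hq.2.1 (c.hv i) v

lemma exists_cubic (P : Fin 9 → V3) :
    ∃ f : R3, f.IsHomogeneous 3 ∧ f ≠ 0 ∧ ∀ i, eval (P i) f = 0 := by
  let Φ : homogeneousSubmodule (Fin 3) ℝ 3 →ₗ[ℝ] (Fin 9 → ℝ) :=
    { toFun := fun h i => eval (P i) h.1
      map_add' := by intro a b; ext i; simp
      map_smul' := by intro a b; ext i; simp [smul_eval] }
  have hk : LinearMap.ker Φ ≠ ⊥ := by
    apply LinearMap.ker_ne_bot_of_finrank_lt
    rw [finrank_hom]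
    simp [Nat.choose]
  obtain ⟨f, hf, hf0⟩ := Submodule.exists_mem_ne_zero_of_ne_bot hk
  refine ⟨f.1, f.2, fun h => hf0 (Subtype.ext h), fun i => ?_⟩
  exact congrFun hf i

lemma Conf.nonsing {P : Fin 9 → V3} {q : R3} (c : Conf P q) {f : R3} (hf : f.IsHomogeneous 3)
    (hf0 : f ≠ 0) (hfP : ∀ i, eval (P i) f = 0) (k : Fin 9) : ∃ v, _root_.dd f (P k) v ≠ 0 := by
  by_contra hcon
  push Not at hcon
  have := bezout hf c.hq.1 hf0 (ext_ne c.hq) (ext_relPrime c.hq le_rfl hf hf0) P c.h0 c.hP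
    (fun i => LinearMap.ker (ddL f (P i))) hfP c.hv
    (fun i v hv => by simpa using hv) (fun i v _ => c.dd i v)
  have h3 : Module.finrank ℝ (LinearMap.ker (ddL f (P k))) = 3 := by
    have : LinearMap.ker (ddL f (P k)) = ⊤ := by
      ext v; simp [hcon v]
    rw [this]; simp
  have h2 : ∑ i : Fin 9, (2 + if i = k then 1 else 0) ≤ ∑ i, Module.finrank ℝ (LinearMap.ker (ddL f (P i))) := by
    refine Finset.sum_le_sum (fun i _ => ?_)
    by_cases h : i = k
    · subst h; simp [h3]
    · simp [h]; exact finrank_ker_dd f (P i)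
  rw [Finset.sum_add_distrib] at h2
  simp at h2
  omega

lemma exists_extra {P : Fin 9 → V3} (h0 : ∀ i, P i ≠ 0) {f : R3} (hf : f.IsHomogeneous 3)
    (hf0 : f ≠ 0) : ∃ p : V3, p ≠ 0 ∧ (∀ i, LinearIndependent ℝ ![p, P i]) ∧ eval p f = 0 := by
  obtain ⟨w, hw⟩ := exists_eval_ne hf0
  have hneg : eval (-w) f = - eval w f := by
    have := eval_smul_hom hf (-1) w
    simp at this
    rw [this]; ring
  obtain ⟨u, v, hu, hv⟩ : ∃ u v : V3, 0 < eval u f ∧ eval v f < 0 := by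
    rcases lt_or_gt_of_ne hw with h | h
    · exact ⟨-w, w, by rw [hneg]; linarith, h⟩
    · exact ⟨w, -w, h, by rw [hneg]; linarith⟩
  obtain ⟨w, hw0, hwi, hwf, _⟩ := signpts hf hu hv 10
  by_contra hcon
  push Not at hcon
  have : ∀ i, ∃ j, ¬ LinearIndependent ℝ ![w i, P j] := by
    intro i
    by_contra h
    push Not at h
    exact hcon (w i) (hw0 i) h (hwf i)
  choose j hj using this
  obtain ⟨a, b, hab, hjab⟩ := Fintype.exists_ne_map_eq_of_card_lt j (by simp)
  have hdep : ∀ i, ∃ c : ℝ, c • P (j i) = w i := by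
    intro i
    have h1 := hj i
    rw [LinearIndependent.pair_symm_iff, LinearIndependent.pair_iff' (h0 _)] at h1
    push Not at h1
    exact h1
  obtain ⟨c1, hc1⟩ := hdep a
  obtain ⟨c2, hc2⟩ := hdep b
  have hc10 : c1 ≠ 0 := by
    rintro rfl
    rw [zero_smul] at hc1
    exact hw0 a hc1.symm
  have hi := hwi a b hab
  rw [LinearIndependent.pair_iff' (hw0 a)] at hi
  apply hi (c2 / c1)
  rw [← hc1, ← hc2, hjab, smul_smul, div_mul_cancel₀ _ hc10]

lemma eval_ne_of_isUnit {c : R3} (hc : IsUnit c) (u : V3) : eval u c ≠ 0 :=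
  (hc.map (eval u)).ne_zero

lemma pts_card (Q : Fin 9 → Prop) :
    Nat.card {i // Q i} + Nat.card {i // ¬ Q i} = 9 := by
  classical
  rw [Nat.card_eq_fintype_card, Nat.card_eq_fintype_card, Fintype.card_subtype_compl]
  have := Fintype.card_subtype_le Q
  simp at this ⊢
  omega

/-- counting on the locus where the common factor vanishes -/
lemma Conf.countc {P : Fin 9 → V3} {q : R3} (c : Conf P q) {g : R3} {k : ℕ} (hk : k ≤ 3)
    (hg : g.IsHomogeneous k) (hg0 : g ≠ 0) {Q : Fin 9 → Prop} (hQ : ∀ i, Q i → eval (P i) g = 0) :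
    2 * Nat.card {i // Q i} ≤ k * 6 := by
  classical
  rw [Nat.card_eq_fintype_card]
  exact count2 hg c.hq.1 hg0 (ext_ne c.hq) (ext_relPrime c.hq hk hg hg0) (fun i : {i // Q i} => P i)
    (fun i => c.h0 i) (fun i j hij => c.hP i j (fun h => hij (Subtype.ext h)))
    (fun i => hQ i i.2) (fun i => c.hv i) (fun i v => c.dd i v)

lemma Conf.div6 {P : Fin 9 → V3} {q : R3} (cf : Conf P q) {f : R3} (hf : f.IsHomogeneous 3)
    (hf0 : f ≠ 0) (hfP : ∀ i, eval (P i) f = 0) {p : V3} (hp0 : p ≠ 0)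
    (hp : ∀ i, LinearIndependent ℝ ![p, P i]) (hfp : eval p f = 0)
    {w : R3} (hw : w.IsHomogeneous 6) (hwP : ∀ i, eval (P i) w = 0)
    (hwd : ∀ i v, _root_.dd w (P i) v = 0) (hwp : eval p w = 0) :
    ∃ h : R3, h.IsHomogeneous 3 ∧ (∀ i, eval (P i) h = 0) ∧ w = f * h := by
  by_cases hw0 : w = 0
  · exact ⟨0, isHomogeneous_zero _ _ _, by simp, by simp [hw0]⟩
  have hdvd : f ∣ w := by
    obtain ⟨f2, w2, c, hrel, hcf, hcw⟩ := UniqueFactorizationMonoid.exists_reduced_factors f hf0 w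
    have hc0 : c ≠ 0 := by rintro rfl; simp at hcf; exact hf0 hcf.symm
    have hf20 : f2 ≠ 0 := by rintro rfl; simp at hcf; exact hf0 hcf.symm
    have hw20 : w2 ≠ 0 := by rintro rfl; simp at hcw; exact hw0 hcw.symm
    obtain ⟨k, a, hck, hfa, hka⟩ := isHomogeneous_of_mul (hcf ▸ hf) (hcf ▸ hf0)
    obtain ⟨_, hw2h⟩ := isHomogeneous_of_mul_right (hcw ▸ hw) hck (hcw ▸ hw0)
    by_cases ha0 : a = 0
    · subst ha0
      have hu := isUnit_of_hom0 hfa hf20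
      rw [← hcf, ← hcw]
      exact mul_dvd_mul_left c (hu.dvd)
    exfalso
    have hcP : ∀ i, eval (P i) f2 = 0 → eval (P i) c ≠ 0 := by
      intro i h1 h2
      obtain ⟨v, hv⟩ := cf.nonsing hf hf0 hfP i
      apply hv
      rw [← hcf, dd_mul, h1, h2]; simp
    have hw2P : ∀ i, eval (P i) f2 = 0 → eval (P i) w2 = 0 := by
      intro i h1
      have := hwP i
      rw [← hcw, map_mul] at this
      exact (mul_eq_zero.mp this).resolve_left (hcP i h1)
    have hw2d : ∀ i, eval (P i) f2 = 0 → ∀ v, _root_.dd w2 (P i) v = 0 := by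
      intro i h1 v
      have := hwd i v
      rw [← hcw, dd_mul, hw2P i h1] at this
      simp at this
      exact this.resolve_left (hcP i h1)
    by_cases ha3 : a = 3
    · subst ha3
      have hk0 : k = 0 := by omega
      subst hk0
      have hu := isUnit_of_hom0 hck hc0
      have hf2 : ∀ x, eval x f = 0 → eval x f2 = 0 := by
        intro x hx
        rw [← hcf, map_mul] at hx
        exact (mul_eq_zero.mp hx).resolve_left (eval_ne_of_isUnit hu x)
      have hw2p : eval p w2 = 0 := by
        rw [← hcw, map_mul] at hwp
        exact (mul_eq_zero.mp hwp).resolve_left (eval_ne_of_isUnit hu p)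
      have := count2' hfa hw2h hf20 hw20 hrel P cf.h0 cf.hP (fun i => hf2 _ (hfP i))
        (fun i => hw2P i (hf2 _ (hfP i))) (fun i v => hw2d i (hf2 _ (hfP i)) v) hp0 hp (hf2 p hfp) hw2p
      simp at this
    · classical
      have h1 := pts_card (fun i => eval (P i) f2 = 0)
      have h2 := cf.countc (by omega) hck hc0 (Q := fun i => ¬ eval (P i) f2 = 0) (fun i hi => by
        have := hfP i
        rw [← hcf, map_mul] at this
        exact (mul_eq_zero.mp this).resolve_right hi)
      have h3 : 2 * Nat.card {i // eval (P i) f2 = 0} ≤ a * (6 - k) := by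
        rw [Nat.card_eq_fintype_card]
        exact count2 hfa hw2h hf20 hw20 hrel (fun i : {i // eval (P i) f2 = 0} => P i)
          (fun i => cf.h0 i) (fun i j hij => cf.hP i j (fun h => hij (Subtype.ext h)))
          (fun i => i.2) (fun i => hw2P i i.2) (fun i v => hw2d i i.2 v)
      have : a = 1 ∧ k = 2 ∨ a = 2 ∧ k = 1 := by omega
      rcases this with ⟨rfl, rfl⟩ | ⟨rfl, rfl⟩ <;> omega
  obtain ⟨h, hh⟩ := hdvd
  refine ⟨h, (isHomogeneous_of_mul_right (hh ▸ hw) hf (hh ▸ hw0)).2, fun i => ?_, hh⟩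
  obtain ⟨v, hv⟩ := cf.nonsing hf hf0 hfP i
  have := hwd i v
  rw [hh, dd_mul, hfP i] at this
  simp at this
  exact this.resolve_right hv

lemma Conf.div3 {P : Fin 9 → V3} {q : R3} (cf : Conf P q) {f : R3} (hf : f.IsHomogeneous 3)
    (hf0 : f ≠ 0) (hfP : ∀ i, eval (P i) f = 0) {p : V3} (hp0 : p ≠ 0)
    (hp : ∀ i, LinearIndependent ℝ ![p, P i]) (hfp : eval p f = 0)
    {w : R3} (hw : w.IsHomogeneous 3) (hwP : ∀ i, eval (P i) w = 0) (hwp : eval p w = 0) :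
    ∃ γ : ℝ, w = γ • f := by
  by_cases hw0 : w = 0
  · exact ⟨0, by simp [hw0]⟩
  have hdvd : f ∣ w := by
    obtain ⟨f2, w2, c, hrel, hcf, hcw⟩ := UniqueFactorizationMonoid.exists_reduced_factors f hf0 w
    have hc0 : c ≠ 0 := by rintro rfl; simp at hcf; exact hf0 hcf.symm
    have hf20 : f2 ≠ 0 := by rintro rfl; simp at hcf; exact hf0 hcf.symm
    have hw20 : w2 ≠ 0 := by rintro rfl; simp at hcw; exact hw0 hcw.symm
    obtain ⟨k, a, hck, hfa, hka⟩ := isHomogeneous_of_mul (hcf ▸ hf) (hcf ▸ hf0)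
    obtain ⟨_, hw2h⟩ := isHomogeneous_of_mul_right (hcw ▸ hw) hck (hcw ▸ hw0)
    by_cases ha0 : a = 0
    · subst ha0
      have hu := isUnit_of_hom0 hfa hf20
      rw [← hcf, ← hcw]
      exact mul_dvd_mul_left c (hu.dvd)
    exfalso
    have hcP : ∀ i, eval (P i) f2 = 0 → eval (P i) c ≠ 0 := by
      intro i h1 h2
      obtain ⟨v, hv⟩ := cf.nonsing hf hf0 hfP i
      apply hv
      rw [← hcf, dd_mul, h1, h2]; simp
    have hw2P : ∀ i, eval (P i) f2 = 0 → eval (P i) w2 = 0 := by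
      intro i h1
      have := hwP i
      rw [← hcw, map_mul] at this
      exact (mul_eq_zero.mp this).resolve_left (hcP i h1)
    by_cases ha3 : a = 3
    · subst ha3
      have hk0 : k = 0 := by omega
      subst hk0
      have hu := isUnit_of_hom0 hck hc0
      have hf2 : ∀ x, eval x f = 0 → eval x f2 = 0 := by
        intro x hx
        rw [← hcf, map_mul] at hx
        exact (mul_eq_zero.mp hx).resolve_left (eval_ne_of_isUnit hu x)
      have hw2p : eval p w2 = 0 := by
        rw [← hcw, map_mul] at hwp
        exact (mul_eq_zero.mp hwp).resolve_left (eval_ne_of_isUnit hu p)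
      have := bezout_pts hfa hw2h hf20 hw20 hrel (optPts P p)
        (by rintro (_ | i); exact hp0; exact cf.h0 i) (optPts_indep cf.hP hp)
        (by rintro (_ | i); exact hf2 p hfp; exact hf2 _ (hfP i))
        (by rintro (_ | i); exact hw2p; exact hw2P i (hf2 _ (hfP i)))
      simp at this
    · classical
      have h1 := pts_card (fun i => eval (P i) f2 = 0)
      have h2 := cf.countc (by omega) hck hc0 (Q := fun i => ¬ eval (P i) f2 = 0) (fun i hi => by
        have := hfP i
        rw [← hcf, map_mul] at this
        exact (mul_eq_zero.mp this).resolve_right hi)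
      have h3 : Nat.card {i // eval (P i) f2 = 0} ≤ a * (3 - k) := by
        rw [Nat.card_eq_fintype_card]
        exact bezout_pts hfa hw2h hf20 hw20 hrel (fun i : {i // eval (P i) f2 = 0} => P i)
          (fun i => cf.h0 i) (fun i j hij => cf.hP i j (fun h => hij (Subtype.ext h)))
          (fun i => i.2) (fun i => hw2P i i.2)
      have : a = 1 ∧ k = 2 ∨ a = 2 ∧ k = 1 := by omega
      rcases this with ⟨rfl, rfl⟩ | ⟨rfl, rfl⟩ <;> omega
  obtain ⟨h, hh⟩ := hdvd
  have hh0 : h.IsHomogeneous 0 := (isHomogeneous_of_mul_right (hh ▸ hw) hf (hh ▸ hw0)).2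
  rw [← totalDegree_zero_iff_isHomogeneous, totalDegree_eq_zero_iff_eq_C] at hh0
  refine ⟨coeff 0 h, ?_⟩
  rw [smul_eq_C_mul, ← hh0, hh, mul_comm]

lemma Conf.qp {P : Fin 9 → V3} {q : R3} (cf : Conf P q) {f : R3} (hf : f.IsHomogeneous 3)
    (hf0 : f ≠ 0) (hfP : ∀ i, eval (P i) f = 0) {p : V3} (hp0 : p ≠ 0)
    (hp : ∀ i, LinearIndependent ℝ ![p, P i]) (hfp : eval p f = 0) : 0 < eval p q := by
  refine lt_of_le_of_ne (cf.hq.2.1 p) (fun h => ?_)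
  have := count2' hf cf.hq.1 hf0 (ext_ne cf.hq) (ext_relPrime cf.hq le_rfl hf hf0) P cf.h0 cf.hP
    hfP cf.hv cf.dd hp0 hp hfp h.symm
  simp at this

lemma Conf.cubics {P : Fin 9 → V3} {q : R3} (cf : Conf P q) {f : R3} (hf : f.IsHomogeneous 3)
    (hf0 : f ≠ 0) (hfP : ∀ i, eval (P i) f = 0) {p : V3} (hp0 : p ≠ 0)
    (hp : ∀ i, LinearIndependent ℝ ![p, P i]) (hfp : eval p f = 0)
    {h : R3} (hh : h.IsHomogeneous 3) (hhP : ∀ i, eval (P i) h = 0) : ∃ γ : ℝ, h = γ • f := by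
  by_contra hcon
  push Not at hcon
  have hhp : eval p h ≠ 0 := by
    intro h0
    obtain ⟨γ, hγ⟩ := cf.div3 hf hf0 hfP hp0 hp hfp hh hhP h0
    exact hcon γ hγ
  have hqp := cf.qp hf hf0 hfP hp0 hp hfp
  obtain ⟨α, hα, hαe⟩ : ∃ α : ℝ, 0 < α ∧ α * eval p q = eval p h ^ 2 :=
    ⟨eval p h ^ 2 / eval p q, by positivity, by field_simp⟩
  obtain ⟨h', hh', hh'P, he⟩ := cf.div6 hf hf0 hfP hp0 hp hfp (w := h ^ 2 + (-α) • q)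
    ((hh.pow 2).add (by rw [smul_eq_C_mul]; exact cf.hq.1.C_mul _))
    (fun i => by simp [smul_eval, hhP i, cf.hv i])
    (fun i v => by rw [dd_add, dd_smul, cf.dd, pow_two, dd_mul, hhP i]; simp)
    (by simp [smul_eval]; linarith)
  obtain ⟨β, hβ⟩ : ∃ β : ℝ, β * eval p h = eval p h' := ⟨eval p h' / eval p h, by field_simp⟩
  obtain ⟨γ, hγ⟩ := cf.div3 hf hf0 hfP hp0 hp hfp (w := h' + (-β) • h)
    (hh'.add (by rw [smul_eq_C_mul]; exact hh.C_mul _))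
    (fun i => by simp [smul_eval, hhP i, hh'P i])
    (by simp [smul_eval]; linarith)
  have hqe : C α * q = (h - C (β / 2) * f) ^ 2 - C (γ + β ^ 2 / 4) * f ^ 2 := by
    simp only [smul_eq_C_mul, C_neg] at he hγ
    have e1 : C (β / 2) * 2 = (C β : R3) := by
      rw [show (2 : R3) = C 2 from rfl, ← C_mul]; congr 1; ring
    have e2 : C (γ + β ^ 2 / 4) = (C γ + C (β / 2) ^ 2 : R3) := by
      rw [← C_pow, ← C_add]; congr 1; ring
    rw [e2]
    linear_combination -he - f * hγ + f * h * e1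
  have hqe2 : ∀ r : R3, C α * q = r → q = C α⁻¹ * r := by
    rintro r rfl
    rw [← mul_assoc, ← C_mul, inv_mul_cancel₀ hα.ne', C_1, one_mul]
  set δ := γ + β ^ 2 / 4 with hδ
  rcases lt_or_ge 0 δ with hd | hd
  · have hfac : q = (h - C (β / 2) * f - C (Real.sqrt δ) * f) *
        (C α⁻¹ * (h - C (β / 2) * f + C (Real.sqrt δ) * f)) := by
      rw [hqe2 _ hqe]
      have : (C δ : R3) = C (Real.sqrt δ) ^ 2 := by rw [← C_pow, Real.sq_sqrt hd.le]
      rw [this]; ring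
    set t := h - C (β / 2) * f - C (Real.sqrt δ) * f with ht
    have hth : t.IsHomogeneous 3 := (hh.sub (hf.C_mul _)).sub (hf.C_mul _)
    have ht0 : t ≠ 0 := by
      intro h0
      apply hcon (β / 2 + Real.sqrt δ)
      rw [smul_eq_C_mul, C_add]
      linear_combination h0
    have hrel := ext_relPrime cf.hq le_rfl hth ht0
    have hu : IsUnit t := hrel dvd_rfl ⟨_, hfac⟩
    apply eval_ne_of_isUnit hu (P 0)
    simp [ht, hhP 0, hfP 0]
  · apply cf.hq.2.2.1
    have hsq : (h - C (β / 2) * f) ^ 2 - C δ * f ^ 2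
        = (h - C (β / 2) * f) ^ 2 + (-δ) • f ^ 2 := by
      rw [smul_eq_C_mul, C_neg]; ring
    have hqf : q = α⁻¹ • ((h - C (β / 2) * f) ^ 2 + (-δ) • f ^ 2) := by
      rw [smul_eq_C_mul, ← hsq]; exact hqe2 _ hqe
    rw [hqf]
    exact sos_sq_smul (by positivity)
      (sos_add (sos_sq _) (sos_sq_smul (c := -δ) (by linarith) (sos_sq _)))

lemma conf_unique {P : Fin 9 → V3} {q q' : R3} (cf : Conf P q) (cf' : Conf P q') :
    ∃ c : ℝ, 0 < c ∧ q' = c • q := by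
  obtain ⟨f, hf, hf0, hfP⟩ := exists_cubic P
  obtain ⟨p, hp0, hp, hfp⟩ := exists_extra cf.h0 hf hf0
  have hqp := cf.qp hf hf0 hfP hp0 hp hfp
  have hqp' := cf'.qp hf hf0 hfP hp0 hp hfp
  obtain ⟨α, hα, hαe⟩ : ∃ α : ℝ, 0 < α ∧ α * eval p q = eval p q' :=
    ⟨eval p q' / eval p q, by positivity, by field_simp⟩
  have hsm : ∀ (c : ℝ) {g : R3} {n : ℕ}, g.IsHomogeneous n → (c • g).IsHomogeneous n := by
    intro c g n hg
    rw [smul_eq_C_mul]; exact hg.C_mul _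
  obtain ⟨h', hh', hh'P, he⟩ := cf.div6 hf hf0 hfP hp0 hp hfp (w := q' + (-α) • q)
    (cf'.hq.1.add (hsm _ cf.hq.1))
    (fun i => by simp [smul_eval, cf'.hv i, cf.hv i])
    (fun i v => by rw [dd_add, dd_smul, cf.dd, cf'.dd]; simp)
    (by simp [smul_eval]; linarith)
  obtain ⟨β, hβ⟩ := cf.cubics hf hf0 hfP hp0 hp hfp hh' hh'P
  have hq' : q' = α • q + β • f ^ 2 := by
    rw [hβ] at he
    simp only [smul_eq_C_mul, C_neg] at he ⊢
    linear_combination he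
  have hpsdsm : ∀ (c : ℝ) {g : R3}, 0 ≤ c → Psd g → Psd (c • g) := by
    intro c g hc hg u
    rw [smul_eval]; exact mul_nonneg hc (hg u)
  have hf2 : Psd (f ^ 2) := fun u => by simp; positivity
  rcases le_or_gt 0 β with hb | hb
  · obtain ⟨⟨c, hc, hce⟩, _⟩ := cf'.hq.2.2.2 (α • q) (β • f ^ 2) (hsm _ cf.hq.1) (hsm _ (hf.pow 2))
      (hpsdsm α hα.le cf.hq.2.1) (hpsdsm β hb hf2) hq'
    have hc0 : c ≠ 0 := by
      rintro rfl
      rw [zero_smul, smul_eq_zero] at hce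
      exact hce.elim hα.ne' (ext_ne cf.hq)
    have hcp : 0 < c := lt_of_le_of_ne hc (Ne.symm hc0)
    refine ⟨c⁻¹ * α, by positivity, ?_⟩
    rw [mul_smul, hce, smul_smul, inv_mul_cancel₀ hc0, one_smul]
  · obtain ⟨⟨c, hc, hce⟩, _⟩ := cf.hq.2.2.2 (α⁻¹ • q') ((α⁻¹ * (-β)) • f ^ 2) (hsm _ cf'.hq.1)
      (hsm _ (hf.pow 2)) (hpsdsm _ (by positivity) cf'.hq.2.1)
      (hpsdsm _ (mul_nonneg (by positivity) (by linarith)) hf2) (by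
        rw [hq', mul_smul, ← smul_add, neg_smul, add_neg_cancel_right, smul_smul,
          inv_mul_cancel₀ hα.ne', one_smul])
    have hc0 : c ≠ 0 := by
      rintro rfl
      rw [zero_smul, smul_eq_zero] at hce
      exact hce.elim (inv_ne_zero hα.ne') (ext_ne cf'.hq)
    have hcp : 0 < c := lt_of_le_of_ne hc (Ne.symm hc0)
    refine ⟨α * c, by positivity, ?_⟩
    rw [mul_smul, ← hce, smul_smul, mul_inv_cancel₀ hα.ne', one_smul]

/-- sextic forms dominated by a multiple of `q` -/
def domSub (q : R3) : Submodule ℝ (homogeneousSubmodule (Fin 3) ℝ 6) where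
  carrier := {p | ∃ M : ℝ, ∀ x : V3, |eval x p.1| ≤ M * eval x q}
  zero_mem' := ⟨0, fun x => by simp⟩
  add_mem' := by
    rintro a b ⟨M, hM⟩ ⟨N, hN⟩
    refine ⟨M + N, fun x => ?_⟩
    have := abs_add_le (eval x a.1) (eval x b.1)
    simp only [Submodule.coe_add, map_add]
    linarith [hM x, hN x]
  smul_mem' := by
    rintro c a ⟨M, hM⟩
    refine ⟨|c| * M, fun x => ?_⟩
    simp only [Submodule.coe_smul, smul_eval, abs_mul, mul_assoc]
    exact mul_le_mul_of_nonneg_left (hM x) (abs_nonneg c)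

lemma hom_smul (c : ℝ) {g : R3} {n : ℕ} (hg : g.IsHomogeneous n) : (c • g).IsHomogeneous n := by
  rw [smul_eq_C_mul]; exact hg.C_mul _

lemma maxt {q q1 : R3} (hq1 : Psd q1) (h0 : q1 ≠ 0) (h1 : Psd (q - q1)) :
    ∃ t : ℝ, 1 ≤ t ∧ Psd (q - t • q1) ∧ ∀ s, t < s → ¬ Psd (q - s • q1) := by
  let T : Set ℝ := {t | Psd (q - t • q1)}
  have hT1 : (1 : ℝ) ∈ T := by show Psd _; rwa [one_smul]
  have hb : ∀ x, 0 < eval x q1 → ∀ t ∈ T, t ≤ eval x q / eval x q1 := by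
    intro x hx t ht
    have := ht x
    rw [map_sub, smul_eval] at this
    rw [le_div_iff₀ hx]; linarith
  obtain ⟨w, hw⟩ := exists_eval_ne h0
  have hbd : BddAbove T := ⟨_, hb w (lt_of_le_of_ne (hq1 w) (Ne.symm hw))⟩
  refine ⟨sSup T, le_csSup hbd hT1, ?_, ?_⟩
  · intro x
    rw [map_sub, smul_eval]
    rcases (hq1 x).lt_or_eq with h | h
    · have := csSup_le ⟨1, hT1⟩ (hb x h)
      rw [le_div_iff₀ h] at this; linarith
    · rw [← h]
      have := hT1 x
      rw [map_sub, smul_eval, ← h] at this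
      linarith
  · intro s hs hps
    exact absurd (le_csSup hbd (show s ∈ T from hps)) (not_le.mpr hs)

lemma domSub_lt {q q1 : R3} (hq1h : q1.IsHomogeneous 6) (hq1 : Psd q1) {t : ℝ}
    (ht1 : 1 ≤ t) (h1 : Psd (q - t • q1)) (h2 : ∀ s, t < s → ¬ Psd (q - s • q1)) :
    domSub (q - t • q1) < domSub q := by
  have hle : ∀ x, eval x (q - t • q1) ≤ eval x q := by
    intro x
    rw [map_sub, smul_eval]
    have := mul_nonneg (by linarith : (0 : ℝ) ≤ t) (hq1 x)
    linarith
  rw [SetLike.lt_iff_le_and_exists]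
  refine ⟨?_, ⟨q1, hq1h⟩, ?_, ?_⟩
  · rintro p ⟨M, hM⟩
    refine ⟨|M|, fun x => (hM x).trans ?_⟩
    calc _ ≤ |M| * eval x (q - t • q1) := mul_le_mul_of_nonneg_right (le_abs_self M) (h1 x)
      _ ≤ _ := mul_le_mul_of_nonneg_left (hle x) (abs_nonneg M)
  · refine ⟨1, fun x => ?_⟩
    rw [one_mul, abs_of_nonneg (hq1 x)]
    have := h1 x
    rw [map_sub, smul_eval] at this
    nlinarith [hq1 x]
  · rintro ⟨M, hM⟩
    have hM' : 0 < |M| + 1 := by positivity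
    apply h2 (t + (|M| + 1)⁻¹) (by linarith [inv_pos.mpr hM'])
    intro x
    have h3 := hM x
    simp only at h3
    rw [abs_of_nonneg (hq1 x)] at h3
    have h4 : eval x q1 ≤ (|M| + 1) * eval x (q - t • q1) :=
      h3.trans (mul_le_mul_of_nonneg_right (by linarith [le_abs_self M]) (h1 x))
    have h5 : (|M| + 1)⁻¹ * eval x q1 ≤ eval x (q - t • q1) := by
      rw [inv_mul_le_iff₀ hM']; exact h4
    rw [map_sub, smul_eval] at h5 ⊢
    linarith

lemma exists_extreme (Z : Set V3) : ∀ (n : ℕ) (q : R3), q.IsHomogeneous 6 → Psd q → ¬ Sos q →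
    (∀ x ∈ Z, eval x q = 0) → Module.finrank ℝ (domSub q) ≤ n →
    ∃ q', IsExtremeSextic q' ∧ ∀ x ∈ Z, eval x q' = 0 := by
  intro n
  induction n with
  | zero =>
    intro q hh hpsd hns hZ hn
    exfalso
    have hbot : domSub q = ⊥ := Submodule.finrank_eq_zero.mp (Nat.le_zero.mp hn)
    have hmem : (⟨q, hh⟩ : homogeneousSubmodule (Fin 3) ℝ 6) ∈ domSub q :=
      ⟨1, fun x => by rw [one_mul, abs_of_nonneg (hpsd x)]⟩
    rw [hbot, Submodule.mem_bot] at hmem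
    have : q = 0 := congrArg Subtype.val hmem
    exact hns ⟨0, Fin.elim0, by simp [this]⟩
  | succ n ih =>
    intro q hh hpsd hns hZ hn
    by_cases hex : IsExtremeSextic q
    · exact ⟨q, hex, hZ⟩
    have hq0 : q ≠ 0 := by rintro rfl; exact hns ⟨0, Fin.elim0, by simp⟩
    obtain ⟨w, hw⟩ := exists_eval_ne hq0
    have hwp : 0 < eval w q := lt_of_le_of_ne (hpsd w) (Ne.symm hw)
    have hmul : ∀ a b : R3, Psd b → q = a + b → (∃ c : ℝ, 0 ≤ c ∧ a = c • q) →
        ∃ c : ℝ, 0 ≤ c ∧ b = c • q := by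
      rintro a b hb he ⟨c, hc, rfl⟩
      have hbe : b = (1 - c) • q := by rw [sub_smul, one_smul]; exact eq_sub_of_add_eq' he.symm
      refine ⟨1 - c, ?_, hbe⟩
      have := hb w
      rw [hbe, smul_eval] at this
      exact nonneg_of_mul_nonneg_left this hwp
    obtain ⟨q1, q2, hh1, hh2, hp1, hp2, he, hn1, hn2⟩ : ∃ q1 q2 : R3, q1.IsHomogeneous 6 ∧
        q2.IsHomogeneous 6 ∧ Psd q1 ∧ Psd q2 ∧ q = q1 + q2 ∧ (¬ ∃ c : ℝ, 0 ≤ c ∧ q1 = c • q) ∧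
        (¬ ∃ c : ℝ, 0 ≤ c ∧ q2 = c • q) := by
      by_contra hcon
      apply hex
      refine ⟨hh, hpsd, hns, fun q1 q2 hh1 hh2 hp1 hp2 he => ?_⟩
      by_contra hno
      apply hcon
      refine ⟨q1, q2, hh1, hh2, hp1, hp2, he, fun h => ?_, fun h => ?_⟩
      · exact hno ⟨h, hmul q1 q2 hp2 he h⟩
      · exact hno ⟨hmul q2 q1 hp1 (by rw [he, add_comm]) h, h⟩
    have hq10 : q1 ≠ 0 := by rintro rfl; exact hn1 ⟨0, le_rfl, by simp⟩
    have hq20 : q2 ≠ 0 := by rintro rfl; exact hn2 ⟨0, le_rfl, by simp⟩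
    obtain ⟨t, ht1, htp, htm⟩ := maxt (q := q) hp1 hq10 (by rw [he]; simpa using hp2)
    obtain ⟨s, hs1, hsp, hsm⟩ := maxt (q := q) hp2 hq20 (by rw [he]; simpa using hp1)
    have step : ∀ (a : R3) (r : ℝ), a.IsHomogeneous 6 → Psd a → 1 ≤ r → Psd (q - r • a) →
        (∀ s, r < s → ¬ Psd (q - s • a)) → ¬ Sos (q - r • a) →
        ∃ q', IsExtremeSextic q' ∧ ∀ x ∈ Z, eval x q' = 0 := by
      intro a r ha hap hr hrp hrm hnsr
      have hlt := Submodule.finrank_lt_finrank_of_lt (domSub_lt ha hap hr hrp hrm)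
      refine ih (q - r • a) (hh.sub (hom_smul r ha)) hrp hnsr (fun x hx => ?_) (by omega)
      have h1 := hrp x
      rw [map_sub, smul_eval, hZ x hx] at h1 ⊢
      have := mul_nonneg (by linarith : (0 : ℝ) ≤ r) (hap x)
      linarith
    by_cases hs1' : Sos (q - t • q1)
    · by_cases hs2' : Sos (q - s • q2)
      · exfalso
        have hid : s • (q - t • q1) + t • (q - s • q2) = (s + t - s * t) • q := by
          rw [he]
          simp only [smul_eq_C_mul, C_add, C_sub, C_mul]
          ring
        rcases lt_or_ge 0 (s + t - s * t) with hpos | hneg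
        · apply hns
          have : q = (s + t - s * t)⁻¹ • (s • (q - t • q1) + t • (q - s • q2)) := by
            rw [hid, smul_smul, inv_mul_cancel₀ hpos.ne', one_smul]
          rw [this]
          exact sos_sq_smul (by positivity)
            (sos_add (sos_sq_smul (by linarith) hs1') (sos_sq_smul (by linarith) hs2'))
        · apply hn1
          refine ⟨t⁻¹, by positivity, ?_⟩
          have hr0 : q - t • q1 = 0 := by
            apply MvPolynomial.funext
            intro x
            have hx := congrArg (eval x) hid
            rw [map_add, smul_eval, smul_eval, smul_eval] at hx
            have a1 := htp x
            have a2 := hsp x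
            have a3 := mul_nonneg (by linarith : (0 : ℝ) ≤ t) a2
            have a4 := mul_nonpos_of_nonpos_of_nonneg hneg (hpsd x)
            rw [map_zero]
            nlinarith
          rw [sub_eq_zero] at hr0
          rw [hr0, smul_smul, inv_mul_cancel₀ (by linarith), one_smul]
      · exact step q2 s hh2 hp2 hs1 hsp hsm hs2'
    · exact step q1 t hh1 hp1 ht1 htp htm hs1'

theorem statement12 (S : Set P2) (hS9 : S.encard = 9)
    (hex : ∃ g : MvPolynomial (Fin 3) ℝ, g.IsHomogeneous 6 ∧ Psd g ∧
      (∀ P ∈ S, VanishAt g P) ∧ ¬ Sos g) :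
    (∃ q : MvPolynomial (Fin 3) ℝ, IsExtremeSextic q ∧ ∀ P ∈ S, VanishAt q P) ∧
    ∀ q q' : MvPolynomial (Fin 3) ℝ,
      IsExtremeSextic q → (∀ P ∈ S, VanishAt q P) →
      IsExtremeSextic q' → (∀ P ∈ S, VanishAt q' P) →
      ∃ c : ℝ, 0 < c ∧ q' = c • q := by
  constructor
  · obtain ⟨g, hh, hpsd, hv, hns⟩ := hex
    obtain ⟨q, hq, hZ⟩ := exists_extreme {x | ∃ P ∈ S, x = P.rep} _ g hh hpsd hns
      (by rintro x ⟨P, hP, rfl⟩; exact hv P hP) le_rfl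
    exact ⟨q, hq, fun P hP => hZ _ ⟨P, hP, rfl⟩⟩
  · intro q q' hq hqv hq' hqv'
    have hfin : Finite S := Set.finite_of_encard_eq_coe (k := 9) hS9
    have hcard : Nat.card S = 9 := by
      have h1 : Nat.card S = S.ncard := rfl
      rw [h1, Set.ncard, hS9]; rfl
    let e := Finite.equivFinOfCardEq hcard
    let P : Fin 9 → V3 := fun i => (e.symm i).1.rep
    have h0 : ∀ i, P i ≠ 0 := fun i => (e.symm i).1.rep_nonzero
    have hP : ∀ i j, i ≠ j → LinearIndependent ℝ ![P i, P j] := by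
      intro i j hij
      have hne : (e.symm i).1 ≠ (e.symm j).1 := fun h => hij (e.symm.injective (Subtype.ext h))
      have h1 := (Projectivization.independent_pair_iff_ne _ _).mpr hne
      rw [Projectivization.independent_iff] at h1
      have h2 : (Projectivization.rep ∘ ![(e.symm i).1, (e.symm j).1]) = ![P i, P j] := by
        funext k; fin_cases k <;> rfl
      rw [h2] at h1
      exact h1
    exact conf_unique ⟨h0, hP, hq, fun i => hqv _ (e.symm i).2⟩
      ⟨h0, hP, hq', fun i => hqv' _ (e.symm i).2⟩

end
end

section
/- Let p, q ∈ ℝ[x₀,x₁,x₂] be forms of the same even degree. Assume p is psd, and that for every point P ∈ ℙ²(ℝ) at which p vanishes there exist a real number t and an open neighborhood U of P in ℙ²(ℝ) such that q + t·p is nonnegative on (representative vectors of points of) U. Then there exists a real number t such that q + t·p is psd, i.e. nonnegative on all of ℝ³. -/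
open MvPolynomial

noncomputable section

/-- The quotient topology on the real projective plane. -/
instance : TopologicalSpace P2 :=
  inferInstanceAs (TopologicalSpace (Quotient (projectivizationSetoid ℝ (Fin 3 → ℝ))))

theorem eval_smul_form {n : ℕ} {f : MvPolynomial (Fin 3) ℝ} (hf : f.IsHomogeneous n)
    (c : ℝ) (u : Fin 3 → ℝ) : eval (c • u) f = c ^ n * eval u f := by
  rw [eval_eq, eval_eq, Finset.mul_sum]
  refine Finset.sum_congr rfl fun m hm => ?_
  have h : ∑ i ∈ m.support, m i = n := by
    have h1 := hf (mem_support_iff.mp hm)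
    rw [Finsupp.weight_apply] at h1
    simpa [Finsupp.sum] using h1
  have h2 : ∏ i ∈ m.support, (c • u) i ^ m i = c ^ n * ∏ i ∈ m.support, u i ^ m i := by
    simp only [Pi.smul_apply, smul_eq_mul, mul_pow, Finset.prod_mul_distrib]
    rw [Finset.prod_pow_eq_pow_sum, h]
  rw [h2]; ring

theorem nonneg_of_smul {d : ℕ} {f : MvPolynomial (Fin 3) ℝ} (hf : f.IsHomogeneous (2 * d))
    (c : ℝ) (u : Fin 3 → ℝ) (h : 0 ≤ eval u f) : 0 ≤ eval (c • u) f := by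
  rw [eval_smul_form hf, pow_mul]
  positivity

theorem continuous_mk_P2 :
    Continuous (fun v : {v : Fin 3 → ℝ // v ≠ 0} => (Projectivization.mk ℝ v.1 v.2 : P2)) := by
  exact (continuous_quotient_mk' (s := projectivizationSetoid ℝ (Fin 3 → ℝ)))

theorem local_bound (d : ℕ) (p q : MvPolynomial (Fin 3) ℝ)
    (hp : p.IsHomogeneous (2 * d)) (hq : q.IsHomogeneous (2 * d)) (hppsd : Psd p)
    (hloc : ∀ P : P2, VanishAt p P → ∃ t : ℝ, ∃ U : Set P2, IsOpen U ∧ P ∈ U ∧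
      ∀ Q ∈ U, 0 ≤ eval Q.rep (q + t • p)) (v : Fin 3 → ℝ) (hv : v ≠ 0) :
    ∃ t : ℝ, ∀ᶠ w in nhds v, 0 ≤ eval w (q + t • p) := by
  by_cases h0 : eval v p = 0
  · have hP : VanishAt p (Projectivization.mk ℝ v hv) := by
      obtain ⟨a, ha⟩ := Projectivization.exists_smul_eq_mk_rep ℝ v hv
      unfold VanishAt
      rw [← ha, Units.smul_def, eval_smul_form hp, h0, mul_zero]
    obtain ⟨t, U, hU, hPU, h⟩ := hloc _ hP
    refine ⟨t, ?_⟩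
    have hopen := hU.preimage continuous_mk_P2
    have hne : IsOpen {v : Fin 3 → ℝ | v ≠ 0} := isOpen_ne
    have hopen2 := hne.isOpenMap_subtype_val _ hopen
    have hmem := hopen2.mem_nhds (x := v) ⟨⟨v, hv⟩, hPU, rfl⟩
    filter_upwards [hmem] with w hw
    obtain ⟨⟨w', hw'⟩, hw1, rfl⟩ := hw
    have h1 := h _ hw1
    obtain ⟨a, ha⟩ := Projectivization.exists_smul_eq_mk_rep ℝ w' hw'
    have hf : (q + t • p).IsHomogeneous (2 * d) :=
      (homogeneousSubmodule (Fin 3) ℝ (2 * d)).add_mem hq (Submodule.smul_mem _ t hp)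
    have h2 := nonneg_of_smul hf ((a : ℝ)⁻¹) _ h1
    simp only [← ha, Units.smul_def, smul_smul] at h2
    rwa [inv_mul_cancel₀ a.ne_zero, one_smul] at h2
  · have hcont : Continuous fun w : Fin 3 → ℝ => eval w (q + ((1 - eval v q) / eval v p) • p) :=
      continuous_eval _
    refine ⟨(1 - eval v q) / eval v p, ?_⟩
    have hpos : 0 < eval v (q + ((1 - eval v q) / eval v p) • p) := by
      rw [map_add, smul_eval, div_mul_cancel₀ _ h0]
      linarith
    exact (hcont.continuousAt.eventually (lt_mem_nhds hpos)).mono fun _ h => le_of_lt h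

theorem statement13 (d : ℕ) (p q : MvPolynomial (Fin 3) ℝ)
    (hp : p.IsHomogeneous (2 * d)) (hq : q.IsHomogeneous (2 * d)) (hppsd : Psd p)
    (hloc : ∀ P : P2, VanishAt p P → ∃ t : ℝ, ∃ U : Set P2, IsOpen U ∧ P ∈ U ∧
      ∀ Q ∈ U, 0 ≤ eval Q.rep (q + t • p)) :
    ∃ t : ℝ, Psd (q + t • p) := by
  have key : ∃ t : ℝ, ∀ w ∈ Metric.sphere (0 : Fin 3 → ℝ) 1, 0 ≤ eval w (q + t • p) := by
    refine (isCompact_sphere (0 : Fin 3 → ℝ) 1).induction_on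
      (p := fun s => ∃ t : ℝ, ∀ w ∈ s, 0 ≤ eval w (q + t • p)) ⟨0, by simp⟩ ?_ ?_ ?_
    · rintro s s' hs ⟨t, ht⟩
      exact ⟨t, fun w hw => ht w (hs hw)⟩
    · rintro s s' ⟨t, ht⟩ ⟨t', ht'⟩
      refine ⟨max t t', fun w hw => ?_⟩
      have hpw := hppsd w
      have m1 := mul_le_mul_of_nonneg_right (le_max_left t t') hpw
      have m2 := mul_le_mul_of_nonneg_right (le_max_right t t') hpw
      rw [map_add, smul_eval]
      rcases hw with hw | hw
      · have := ht w hw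
        rw [map_add, smul_eval] at this
        linarith
      · have := ht' w hw
        rw [map_add, smul_eval] at this
        linarith
    · intro v hv
      have hv0 : v ≠ 0 := by
        rintro rfl
        simp at hv
      obtain ⟨t, ht⟩ := local_bound d p q hp hq hppsd hloc v hv0
      exact ⟨_, mem_nhdsWithin_of_mem_nhds ht, t, fun w hw => hw⟩
  obtain ⟨t, ht⟩ := key
  have hf : (q + t • p).IsHomogeneous (2 * d) :=
    (homogeneousSubmodule (Fin 3) ℝ (2 * d)).add_mem hq (Submodule.smul_mem _ t hp)
  refine ⟨t, fun u => ?_⟩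
  by_cases hu : u = 0
  · have h1 := nonneg_of_smul hf 0 (fun _ => 1) (ht (fun _ => 1) (by simp))
    rwa [zero_smul, ← hu] at h1
  · have hn : ‖u‖ ≠ 0 := norm_ne_zero_iff.mpr hu
    have h1 := nonneg_of_smul hf ‖u‖ (‖u‖⁻¹ • u) (ht _ (by simp [norm_smul, hn]))
    rwa [smul_smul, mul_inv_cancel₀ hn, one_smul] at h1

end
end
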